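/- arXiv:math/0608499 — 2 statements merged into one kernel-verified Lean document; each statement's English description precedes it below -/
import Mathlib

section
/- Fix p ≥ 1, n ≥ p + 2, θ₁ > 0 and k′ > 0. Let f(·;0) and f(·;θ₁) be probability densities on ℝ^p. Let LT(p) denote the set of p×p lower triangular matrices T = (t_{ij}) with positive diagonal elements. For X ∈ ℝ^{n×p} with rows x₁,…,xₙ define M_θ(X) = ∫_{LT(p)} ∫_{ℝ^p} ∏_{i=1}^n f(a + T·xᵢ ; θ) da · ∏_{i=1}^p t_{ii}^{n−i−1} ∏_{i≥j} dt_{ij}, and assume M₀(X) and M_{θ₁}(X) are finite with M₀(X) > 0 for a.e. X. Let R* = { X : M_{θ₁}(X) > k′ · M₀(X) }. Then for every measurable R ⊆ ℝ^{n×p} that is invariant under X ↦ 1ₙ a′ + X T′ for all a ∈ ℝ^p and T ∈ LT(p), the inequality ∫_R ∏_{i=1}^n f(xᵢ;0) dX ≤ ∫_{R*} ∏_{i=1}^n f(xᵢ;0) dX implies ∫_R ∏_{i=1}^n f(xᵢ;θ₁) dX ≤ ∫_{R*} ∏_{i=1}^n f(xᵢ;θ₁) dX. -/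
open MeasureTheory
open scoped ENNReal

/-- Index set of the on-or-below-diagonal entries of a `p × p` matrix. -/
abbrev LowIdx (p : ℕ) := {q : Fin p × Fin p // q.2 ≤ q.1}

/-- The lower triangular matrix built from its on-or-below-diagonal entries. -/
def lowMat (p : ℕ) (t : LowIdx p → ℝ) : Matrix (Fin p) (Fin p) ℝ :=
  Matrix.of fun i j => if h : j ≤ i then t ⟨(i, j), h⟩ else 0

/-- The integrated likelihood under the triangular group:
`M_f(X) = ∫_{LT(p)} ∫_{ℝ^p} ∏ᵢ f(a + T xᵢ) da ∏ᵢ t_{ii}^{n-i-1} ∏_{i≥j} dt_{ij}`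
(a Lebesgue integral over the lower-triangular coordinates `t_{ij}`, `i ≥ j`, restricted to
positive diagonal entries; the paper's `i` is 1-based so the exponent is `n - (i+1) - 1`). -/
noncomputable def intLikLT (n p : ℕ) (f : (Fin p → ℝ) → ℝ) (X : Fin n → Fin p → ℝ) : ℝ≥0∞ :=
  ∫⁻ t in {t : LowIdx p → ℝ | ∀ i : Fin p, 0 < t ⟨(i, i), le_rfl⟩}, ∫⁻ a : Fin p → ℝ,
    (∏ i, ENNReal.ofReal (f (a + (lowMat p t).mulVec (X i)))) *
      ENNReal.ofReal (∏ i : Fin p, t ⟨(i, i), le_rfl⟩ ^ (n - (i : ℕ) - 2))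

theorem character_ne_zero {G : Type*} [Group G] (χ : G →* ℝ≥0∞) (g : G) : χ g ≠ 0 := fun h => by
  have := χ.map_one
  rw [← mul_inv_cancel g, map_mul, h, zero_mul] at this
  exact zero_ne_one this

theorem character_inv {G : Type*} [Group G] (χ : G →* ℝ≥0∞) (g : G) : (χ g)⁻¹ = χ g⁻¹ := by
  symm
  apply ENNReal.eq_inv_of_mul_eq_one_left
  rw [← map_mul, inv_mul_cancel, map_one]

theorem character_ne_top {G : Type*} [Group G] (χ : G →* ℝ≥0∞) (g : G) : χ g ≠ ∞ := by
  rw [← inv_inv g, ← character_inv, ENNReal.inv_ne_top]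
  exact character_ne_zero _ _

section Abstract
variable {G : Type*} {𝓧 : Type*} [Group G] [MeasurableSpace G] [MeasurableSpace 𝓧] [MulAction G 𝓧]

/-- Integral of `P` along the orbit of `x`, weighted by the character `J`. -/
noncomputable def orbitIntegral (ν : Measure G) (J : G →* ℝ≥0∞) (P : 𝓧 → ℝ≥0∞) (x : 𝓧) : ℝ≥0∞ :=
  ∫⁻ g, P (g • x) * J g ∂ν

theorem orbitIntegral_smul [MeasurableSMul₂ G 𝓧] (ν : Measure G) (J Δ : G →* ℝ≥0∞)
    (hJ : Measurable J)
    (hΔ : ∀ F : G → ℝ≥0∞, Measurable F → ∀ h, ∫⁻ g, F (g * h) ∂ν = Δ h * ∫⁻ g, F g ∂ν)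
    {P : 𝓧 → ℝ≥0∞} (hP : Measurable P) (h : G) (x : 𝓧) :
    orbitIntegral ν J P (h • x) = J h⁻¹ * Δ h * orbitIntegral ν J P x := by
  have h1 : ∀ g, P (g • h • x) * J g = J h⁻¹ * (P ((g * h) • x) * J (g * h)) := fun g => by
    have : J h⁻¹ * J h = 1 := by rw [← map_mul, inv_mul_cancel, map_one]
    calc _ = P ((g * h) • x) * J g * (J h⁻¹ * J h) := by rw [this, mul_one, mul_smul]
      _ = _ := by rw [map_mul]; ring
  unfold orbitIntegral
  simp only [h1]
  rw [lintegral_const_mul' _ _ (character_ne_top _ _),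
    hΔ (fun g => P (g • x) * J g) (by fun_prop), mul_assoc]

theorem measurable_orbitIntegral [MeasurableSMul₂ G 𝓧] (ν : Measure G) [SFinite ν]
    (J : G →* ℝ≥0∞) (hJ : Measurable J) {P : 𝓧 → ℝ≥0∞} (hP : Measurable P) :
    Measurable (orbitIntegral ν J P) := by
  unfold orbitIntegral
  exact Measurable.lintegral_prod_right (f := fun x g => P (g • x) * J g) (by fun_prop)

variable [MeasurableMul₂ G] [MeasurableInv G]

theorem lintegral_inv_eq_lintegral_mul_modular (ν : Measure G) [SigmaFinite ν]
    [ν.IsMulLeftInvariant] (Δ : G →* ℝ≥0∞)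
    (hΔ : ∀ F : G → ℝ≥0∞, Measurable F → ∀ h, ∫⁻ g, F (g * h) ∂ν = Δ h * ∫⁻ g, F g ∂ν)
    {F : G → ℝ≥0∞} (hF : Measurable F) :
    ∫⁻ g, F g⁻¹ ∂ν = ∫⁻ g, F g * Δ g ∂ν := by
  obtain ⟨A, hA0, hAm, hA1⟩ := exists_pos_lintegral_lt_of_sigmaFinite ν (ε := 1) one_ne_zero
  have hAm' : Measurable fun g => (A g : ℝ≥0∞) := hAm.coe_nnreal_ennreal
  by_cases hA : ∫⁻ g, A g ∂ν = 0
  · rw [lintegral_eq_zero_iff hAm'] at hA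
    have hν : ν = 0 := by
      by_contra hne
      rw [← ae_eq_bot] at hne
      have : (ae ν).NeBot := ⟨hne⟩
      obtain ⟨x, hx⟩ := hA.exists
      simp at hx
      exact (hA0 x).ne' hx
    simp [hν]
  have hmp := measurePreserving_mul_prod_inv ν ν
  have key := hmp.lintegral_comp (f := fun z : G × G => F z.2 * A (z.1 * z.2)) (by fun_prop)
  rw [lintegral_prod _ (by fun_prop), lintegral_prod_symm _ (by fun_prop)] at key
  simp only [mul_inv_cancel_right] at key
  have h1 : ∀ x, ∫⁻ y, F x⁻¹ * A y ∂ν = F x⁻¹ * ∫⁻ y, A y ∂ν :=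
    fun x => lintegral_const_mul _ hAm'
  have h2 : ∀ y, ∫⁻ x, F y * A (x * y) ∂ν = F y * Δ y * ∫⁻ y, A y ∂ν := fun y => by
    rw [lintegral_const_mul _ (by fun_prop), hΔ _ hAm', mul_assoc]
  simp only [h1, h2] at key
  rw [lintegral_mul_const' _ _ (hA1.trans_le le_top).ne,
    lintegral_mul_const' _ _ (hA1.trans_le le_top).ne] at key
  exact (ENNReal.mul_left_inj hA (hA1.trans_le le_top).ne).1 key

/-- The density of `P₁` relative to `P₀` on invariant sets is the ratio of orbit integrals. -/
theorem setLIntegral_eq_lintegral_mul_orbitIntegral_div [MeasurableSMul₂ G 𝓧]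
    (ν : Measure G) [SigmaFinite ν] [ν.IsMulLeftInvariant]
    (lam : Measure 𝓧) [SFinite lam] (J Δ : G →* ℝ≥0∞)
    (hJ : Measurable J) (hΔm : Measurable Δ)
    (hΔ : ∀ F : G → ℝ≥0∞, Measurable F → ∀ h, ∫⁻ g, F (g * h) ∂ν = Δ h * ∫⁻ g, F g ∂ν)
    (hlam : ∀ F : 𝓧 → ℝ≥0∞, Measurable F → ∀ g : G,
      ∫⁻ x, F (g • x) ∂lam = J g⁻¹ * ∫⁻ x, F x ∂lam)
    {P₀ P₁ : 𝓧 → ℝ≥0∞} (hP₀ : Measurable P₀) (hP₁ : Measurable P₁)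
    (hM : ∀ᵐ x ∂lam, orbitIntegral ν J P₀ x ≠ 0 ∧ orbitIntegral ν J P₀ x ≠ ∞)
    {D : Set 𝓧} (hD : MeasurableSet D) (hinv : ∀ (g : G) x, g • x ∈ D ↔ x ∈ D) :
    ∫⁻ x in D, P₁ x ∂lam =
      ∫⁻ x in D, P₀ x * (orbitIntegral ν J P₁ x / orbitIntegral ν J P₀ x) ∂lam := by
  have hM₀ := measurable_orbitIntegral ν J hJ hP₀
  set M₀ := orbitIntegral ν J P₀ with hM₀def
  set χ : 𝓧 → ℝ≥0∞ := D.indicator 1 with hχ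
  have hχm : Measurable χ := measurable_one.indicator hD
  have hχinv : ∀ (g : G) x, χ (g • x) = χ x := fun g x => by
    by_cases hx : x ∈ D <;> simp [hχ, hinv, hx]
  have toχ : ∀ F : 𝓧 → ℝ≥0∞, ∫⁻ x in D, F x ∂lam = ∫⁻ x, χ x * F x ∂lam := fun F => by
    rw [← lintegral_indicator hD]
    congr 1; ext x
    by_cases hx : x ∈ D <;> simp [hχ, hx]
  have hMinv : ∀ (g : G) y, (M₀ (g⁻¹ • y))⁻¹ = J g⁻¹ * Δ g * (M₀ y)⁻¹ := fun g y => by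
    have h0 : J g⁻¹⁻¹ * Δ g⁻¹ ≠ 0 := mul_ne_zero (character_ne_zero _ _) (character_ne_zero _ _)
    have htop : J g⁻¹⁻¹ * Δ g⁻¹ ≠ ∞ :=
      ENNReal.mul_ne_top (character_ne_top _ _) (character_ne_top _ _)
    rw [hM₀def, orbitIntegral_smul ν J Δ hJ hΔ hP₀, ENNReal.mul_inv (.inl h0) (.inl htop),
      ENNReal.mul_inv (.inl (character_ne_zero _ _)) (.inl (character_ne_top _ _)),
      character_inv, character_inv, inv_inv, inv_inv]
  calc ∫⁻ x in D, P₁ x ∂lam = ∫⁻ x, χ x * P₁ x ∂lam := toχ _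
    _ = ∫⁻ x, ∫⁻ g, χ x * P₁ x * (M₀ x)⁻¹ * (P₀ (g • x) * J g) ∂ν ∂lam := by
      apply lintegral_congr_ae
      filter_upwards [hM] with x hx
      rw [lintegral_const_mul _ (by fun_prop)]
      change _ = _ * M₀ x
      rw [mul_assoc, ENNReal.inv_mul_cancel hx.1 hx.2, mul_one]
    _ = ∫⁻ g, ∫⁻ x, χ x * P₁ x * (M₀ x)⁻¹ * (P₀ (g • x) * J g) ∂lam ∂ν :=
      lintegral_lintegral_swap (by fun_prop)
    _ = ∫⁻ g, ∫⁻ y, χ y * P₀ y * (M₀ y)⁻¹ * (P₁ (g⁻¹ • y) * J g⁻¹ * Δ g) ∂lam ∂ν := by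
      congr 1; ext g
      have := hlam (fun y => χ y * P₁ (g⁻¹ • y) * (M₀ (g⁻¹ • y))⁻¹ * (P₀ y * J g))
        (by fun_prop) g
      simp only [inv_smul_smul, hχinv] at this
      rw [this, ← lintegral_const_mul _ (by fun_prop)]
      congr 1; ext y
      have hone : J g⁻¹ * J g = 1 := by rw [← map_mul, inv_mul_cancel, map_one]
      rw [hMinv]
      calc _ = χ y * P₀ y * (M₀ y)⁻¹ * (P₁ (g⁻¹ • y) * J g⁻¹ * Δ g) * (J g⁻¹ * J g) := by ring
        _ = _ := by rw [hone, mul_one]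
    _ = ∫⁻ y, ∫⁻ g, χ y * P₀ y * (M₀ y)⁻¹ * (P₁ (g⁻¹ • y) * J g⁻¹ * Δ g) ∂ν ∂lam :=
      (lintegral_lintegral_swap (by fun_prop)).symm
    _ = ∫⁻ y, χ y * (P₀ y * (orbitIntegral ν J P₁ y / M₀ y)) ∂lam := by
      congr 1; ext y
      rw [lintegral_const_mul _ (by fun_prop)]
      have := lintegral_inv_eq_lintegral_mul_modular ν Δ hΔ
        (F := fun u => P₁ (u • y) * J u * Δ u⁻¹) (by fun_prop)
      simp only [inv_inv] at this
      rw [this]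
      have h2 : ∀ g, P₁ (g • y) * J g * Δ g⁻¹ * Δ g = P₁ (g • y) * J g := fun g => by
        rw [mul_assoc, ← map_mul, inv_mul_cancel, map_one, mul_one]
      simp only [h2]
      change _ * orbitIntegral ν J P₁ y = _
      rw [div_eq_mul_inv]; ring
    _ = _ := (toχ _).symm

/-- Neyman–Pearson lemma for invariant regions. -/
theorem neyman_pearson_invariant [MeasurableSMul₂ G 𝓧]
    (ν : Measure G) [SigmaFinite ν] [ν.IsMulLeftInvariant]
    (lam : Measure 𝓧) [SFinite lam] (J Δ : G →* ℝ≥0∞)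
    (hJ : Measurable J) (hΔm : Measurable Δ)
    (hΔ : ∀ F : G → ℝ≥0∞, Measurable F → ∀ h, ∫⁻ g, F (g * h) ∂ν = Δ h * ∫⁻ g, F g ∂ν)
    (hlam : ∀ F : 𝓧 → ℝ≥0∞, Measurable F → ∀ g : G,
      ∫⁻ x, F (g • x) ∂lam = J g⁻¹ * ∫⁻ x, F x ∂lam)
    {P₀ P₁ : 𝓧 → ℝ≥0∞} (hP₀ : Measurable P₀) (hP₁ : Measurable P₁)
    (hP₀fin : ∫⁻ x, P₀ x ∂lam ≠ ∞)
    (hM : ∀ᵐ x ∂lam, orbitIntegral ν J P₀ x ≠ 0 ∧ orbitIntegral ν J P₀ x ≠ ∞)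
    (k : ℝ≥0∞) {R : Set 𝓧} (hR : MeasurableSet R) (hinv : ∀ (g : G) x, g • x ∈ R ↔ x ∈ R)
    (hsize : ∫⁻ x in R, P₀ x ∂lam ≤
      ∫⁻ x in {x | k * orbitIntegral ν J P₀ x < orbitIntegral ν J P₁ x}, P₀ x ∂lam) :
    ∫⁻ x in R, P₁ x ∂lam ≤
      ∫⁻ x in {x | k * orbitIntegral ν J P₀ x < orbitIntegral ν J P₁ x}, P₁ x ∂lam := by
  have hM₀ := measurable_orbitIntegral ν J hJ hP₀
  have hM₁ := measurable_orbitIntegral ν J hJ hP₁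
  set S := {x | k * orbitIntegral ν J P₀ x < orbitIntegral ν J P₁ x} with hS
  have hSm : MeasurableSet S := measurableSet_lt (by fun_prop) hM₁
  have hSinv : ∀ (g : G) x, g • x ∈ S ↔ x ∈ S := fun g x => by
    simp only [hS, Set.mem_ofPred_eq, orbitIntegral_smul ν J Δ hJ hΔ hP₀,
      orbitIntegral_smul ν J Δ hJ hΔ hP₁]
    rw [mul_left_comm k, ENNReal.mul_lt_mul_iff_right
      (mul_ne_zero (character_ne_zero _ _) (character_ne_zero _ _))
      (ENNReal.mul_ne_top (character_ne_top _ _) (character_ne_top _ _))]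
  have hRS := setLIntegral_eq_lintegral_mul_orbitIntegral_div ν lam J Δ hJ hΔm hΔ hlam hP₀ hP₁
    hM (hR.diff hSm) (fun g x => by simp [hinv, hSinv])
  have hSR := setLIntegral_eq_lintegral_mul_orbitIntegral_div ν lam J Δ hJ hΔm hΔ hlam hP₀ hP₁
    hM (hSm.diff hR) (fun g x => by simp [hinv, hSinv])
  have hle : ∫⁻ x in R \ S, P₁ x ∂lam ≤ k * ∫⁻ x in R \ S, P₀ x ∂lam := by
    rw [hRS, ← lintegral_const_mul _ hP₀]
    apply setLIntegral_mono (by fun_prop)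
    intro x hx
    rw [mul_comm k]
    gcongr
    exact ENNReal.div_le_of_le_mul (not_lt.1 hx.2)
  have hge : k * ∫⁻ x in S \ R, P₀ x ∂lam ≤ ∫⁻ x in S \ R, P₁ x ∂lam := by
    rw [hSR, ← lintegral_const_mul _ hP₀]
    apply setLIntegral_mono_ae (by fun_prop)
    filter_upwards [hM] with x hx hxS
    rw [mul_comm k]
    gcongr
    rw [ENNReal.le_div_iff_mul_le (.inl hx.1) (.inl hx.2)]
    exact le_of_lt hxS.1
  have hsplit : ∀ P : 𝓧 → ℝ≥0∞,
      (∫⁻ x in R, P x ∂lam = ∫⁻ x in R ∩ S, P x ∂lam + ∫⁻ x in R \ S, P x ∂lam) ∧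
      (∫⁻ x in S, P x ∂lam = ∫⁻ x in R ∩ S, P x ∂lam + ∫⁻ x in S \ R, P x ∂lam) := fun P => by
    refine ⟨(lintegral_inter_add_sdiff _ _ hSm).symm, ?_⟩
    rw [Set.inter_comm]
    exact (lintegral_inter_add_sdiff _ _ hR).symm
  rw [(hsplit P₀).1, (hsplit P₀).2] at hsize
  rw [(hsplit P₁).1, (hsplit P₁).2]
  have hfin : ∫⁻ x in R ∩ S, P₀ x ∂lam ≠ ∞ :=
    ((setLIntegral_le_lintegral _ _).trans_lt hP₀fin.lt_top).ne
  have hdiff := (ENNReal.add_le_add_iff_left hfin).1 hsize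
  exact add_le_add le_rfl (hle.trans ((mul_le_mul_right hdiff k).trans hge))
end Abstract

theorem det_eq_prod_diag_of_strict {ι α : Type*} [Fintype ι] [DecidableEq ι] [Fintype α]
    [LinearOrder α] (M : Matrix ι ι ℝ) (b : ι → α)
    (h : ∀ q r, q ≠ r → ¬ b q < b r → M q r = 0) : M.det = ∏ q, M q q := by
  have hb : M.BlockTriangular b := fun q r hqr =>
    h q r (fun e => by simp [e] at hqr) (not_lt_of_gt hqr)
  rw [hb.det_fintype, ← Fintype.prod_fiberwise b fun q => M q q]
  refine Finset.prod_congr rfl fun k _ => ?_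
  have hdiag : M.toSquareBlock b k =
      Matrix.diagonal fun q : {q // b q = k} => M q q := by
    ext q r
    by_cases hqr : q = r
    · simp [hqr, Matrix.toSquareBlock_def]
    · rw [Matrix.diagonal_apply_ne _ hqr]
      exact h _ _ (fun e => hqr (Subtype.ext e)) (by simp [q.2, r.2])
  rw [hdiag, Matrix.det_diagonal]

theorem lintegral_comp_linearMap {E : Type*} [NormedAddCommGroup E] [NormedSpace ℝ E]
    [MeasurableSpace E] [BorelSpace E] [FiniteDimensional ℝ E] (μ : Measure E)
    [μ.IsAddHaarMeasure] (f : E →ₗ[ℝ] E) (hf : 0 < LinearMap.det f) {F : E → ℝ≥0∞}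
    (hF : Measurable F) :
    ∫⁻ x, F (f x) ∂μ = ENNReal.ofReal (LinearMap.det f)⁻¹ * ∫⁻ x, F x ∂μ := by
  have hfm : Measurable f := f.continuous_of_finiteDimensional.measurable
  rw [← lintegral_map hF hfm, Measure.map_linearMap_addHaar_eq_smul_addHaar μ hf.ne',
    lintegral_smul_measure, abs_of_pos (inv_pos.2 hf), smul_eq_mul]

section LowerTriangular
variable {p : ℕ}

theorem lowMat_apply_of_lt (t : LowIdx p → ℝ) {i j : Fin p} (h : i < j) : lowMat p t i j = 0 := by
  simp [lowMat, not_le.2 h]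

theorem lowMat_diag (t : LowIdx p → ℝ) (i : Fin p) : lowMat p t i i = t ⟨(i, i), le_rfl⟩ := by
  simp [lowMat]

/-- The on-or-below-diagonal entries of a matrix. -/
def lowCoord (M : Matrix (Fin p) (Fin p) ℝ) : LowIdx p → ℝ := fun q => M q.1.1 q.1.2

theorem lowMat_lowCoord {M : Matrix (Fin p) (Fin p) ℝ} (h : ∀ i j, i < j → M i j = 0) :
    lowMat p (lowCoord M) = M := by
  ext i j
  by_cases hij : j ≤ i
  · simp [lowMat, lowCoord, hij]
  · rw [lowMat_apply_of_lt _ (not_le.1 hij), h _ _ (not_le.1 hij)]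

theorem lowCoord_lowMat (t : LowIdx p → ℝ) : lowCoord (lowMat p t) = t := by
  ext q
  have := q.2
  simp [lowMat, lowCoord, this]

theorem mul_lower {A B : Matrix (Fin p) (Fin p) ℝ} (hA : ∀ i j, i < j → A i j = 0)
    (hB : ∀ i j, i < j → B i j = 0) (i j : Fin p) (hij : i < j) : (A * B) i j = 0 := by
  rw [Matrix.mul_apply]
  refine Finset.sum_eq_zero fun k _ => ?_
  rcases lt_or_ge i k with h | h
  · rw [hA _ _ h, zero_mul]
  · rw [hB _ _ (h.trans_lt hij), mul_zero]

theorem mul_lower_diag {A B : Matrix (Fin p) (Fin p) ℝ} (hA : ∀ i j, i < j → A i j = 0)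
    (hB : ∀ i j, i < j → B i j = 0) (i : Fin p) : (A * B) i i = A i i * B i i := by
  rw [Matrix.mul_apply]
  refine Finset.sum_eq_single i (fun k _ hk => ?_) (by simp)
  rcases lt_or_gt_of_ne hk with h | h
  · rw [hB _ _ h, mul_zero]
  · rw [hA _ _ h, zero_mul]

theorem det_lower {A : Matrix (Fin p) (Fin p) ℝ} (hA : ∀ i j, i < j → A i j = 0) :
    A.det = ∏ i, A i i :=
  Matrix.det_of_isLowerTriangular A fun i j h => hA i j h

theorem inv_lower {A : Matrix (Fin p) (Fin p) ℝ} (hA : ∀ i j, i < j → A i j = 0)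
    (hdet : IsUnit A.det) (i j : Fin p) (hij : i < j) : A⁻¹ i j = 0 := by
  let _ := Matrix.invertibleOfIsUnitDet A hdet
  have hb : A.BlockTriangular (OrderDual.toDual : Fin p → (Fin p)ᵒᵈ) := fun i j h => hA i j h
  exact Matrix.blockTriangular_inv_of_blockTriangular hb (OrderDual.toDual_lt_toDual.2 hij)

/-- Lower triangular matrices with positive diagonal, in coordinates. -/
def LowTri (p : ℕ) := {t : LowIdx p → ℝ // ∀ i : Fin p, 0 < t ⟨(i, i), le_rfl⟩}

namespace LowTri

/-- The matrix of an element of `LowTri p`. -/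
def mat (t : LowTri p) : Matrix (Fin p) (Fin p) ℝ := lowMat p t.1

theorem mat_of_lt (t : LowTri p) : ∀ i j, i < j → t.mat i j = 0 :=
  fun _ _ h => lowMat_apply_of_lt _ h

theorem mat_diag_pos (t : LowTri p) (i : Fin p) : 0 < t.mat i i := by
  rw [mat, lowMat_diag]; exact t.2 i

theorem det_mat_pos (t : LowTri p) : 0 < t.mat.det := by
  rw [det_lower t.mat_of_lt]; exact Finset.prod_pos fun i _ => t.mat_diag_pos i

theorem isUnit_det (t : LowTri p) : IsUnit t.mat.det := t.det_mat_pos.ne'.isUnit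

theorem mat_injective : Function.Injective (mat : LowTri p → _) := fun s t h =>
  Subtype.ext (by rw [← lowCoord_lowMat s.1, ← lowCoord_lowMat t.1]; exact congrArg lowCoord h)

/-- The element of `LowTri p` with a given matrix. -/
def ofMat (M : Matrix (Fin p) (Fin p) ℝ) (hM : ∀ i, 0 < M i i) : LowTri p :=
  ⟨lowCoord M, hM⟩

theorem mat_ofMat {M : Matrix (Fin p) (Fin p) ℝ} (hM : ∀ i, 0 < M i i)
    (h : ∀ i j, i < j → M i j = 0) : (ofMat M hM).mat = M := lowMat_lowCoord h

theorem inv_diag_pos (t : LowTri p) (i : Fin p) : 0 < t.mat⁻¹ i i := by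
  have h := mul_lower_diag t.mat_of_lt (inv_lower t.mat_of_lt t.isUnit_det) i
  rw [Matrix.mul_nonsing_inv _ t.isUnit_det, Matrix.one_apply_eq] at h
  exact pos_of_mul_pos_right (h ▸ one_pos) (t.mat_diag_pos i).le

instance : Mul (LowTri p) := ⟨fun s t => ofMat (s.mat * t.mat) fun i => by
  rw [mul_lower_diag s.mat_of_lt t.mat_of_lt]; exact mul_pos (s.mat_diag_pos i) (t.mat_diag_pos i)⟩

instance : One (LowTri p) := ⟨ofMat 1 fun i => by simp⟩

noncomputable instance : Inv (LowTri p) := ⟨fun t => ofMat t.mat⁻¹ t.inv_diag_pos⟩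

theorem mat_mul (s t : LowTri p) : (s * t).mat = s.mat * t.mat :=
  mat_ofMat _ (mul_lower s.mat_of_lt t.mat_of_lt)

theorem mat_one : (1 : LowTri p).mat = 1 :=
  mat_ofMat _ fun _ _ h => Matrix.one_apply_ne h.ne

theorem mat_inv (t : LowTri p) : t⁻¹.mat = t.mat⁻¹ :=
  mat_ofMat _ (inv_lower t.mat_of_lt t.isUnit_det)

noncomputable instance : Group (LowTri p) := Group.ofLeftAxioms
  (fun a b c => mat_injective (by simp only [mat_mul, Matrix.mul_assoc]))
  (fun a => mat_injective (by rw [mat_mul, mat_one, Matrix.one_mul]))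
  (fun a => mat_injective (by
    rw [mat_mul, mat_one, mat_inv, Matrix.nonsing_inv_mul _ a.isUnit_det]))

instance : MeasurableSpace (LowTri p) :=
  inferInstanceAs (MeasurableSpace {t : LowIdx p → ℝ // ∀ i : Fin p, 0 < t ⟨(i, i), le_rfl⟩})

theorem measurable_lowMat_apply (i j : Fin p) : Measurable fun t => lowMat p t i j := by
  by_cases h : j ≤ i
  · simp only [lowMat, Matrix.of_apply, h, dite_true]; fun_prop
  · simp only [lowMat, Matrix.of_apply, h, dite_false]; fun_prop

@[fun_prop]
theorem measurable_mat_apply (i j : Fin p) : Measurable fun t : LowTri p => t.mat i j :=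
  (measurable_lowMat_apply i j).comp measurable_subtype_coe

theorem continuous_lowMat : Continuous fun t => lowMat p t := by
  refine continuous_matrix fun i j => ?_
  by_cases h : j ≤ i
  · simp only [lowMat, Matrix.of_apply, h, dite_true]; fun_prop
  · simp only [lowMat, Matrix.of_apply, h, dite_false]; fun_prop

theorem measurable_inv_lowMat_apply (i j : Fin p) :
    Measurable fun t => (lowMat p t)⁻¹ i j := by
  simp only [Matrix.inv_def, Ring.inverse_eq_inv', Matrix.smul_apply, smul_eq_mul]
  exact continuous_lowMat.matrix_det.measurable.inv.mul
    (continuous_lowMat.matrix_adjugate.matrix_elem i j).measurable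

theorem measurable_of_mat {α : Type*} [MeasurableSpace α] {f : α → LowTri p}
    (h : ∀ i j, Measurable fun a => (f a).mat i j) : Measurable f := by
  refine Measurable.subtype_mk (f := fun a => (f a).1) (h := fun a => (f a).2) ?_
  refine measurable_pi_iff.2 fun q => ?_
  have : (fun a => (f a).1 q) = fun a => (f a).mat q.1.1 q.1.2 := by
    ext a; exact (congrFun (lowCoord_lowMat (f a).1) q).symm
  rw [this]; exact h _ _

instance : MeasurableMul₂ (LowTri p) := ⟨measurable_of_mat fun i j => by
  simp only [mat_mul, Matrix.mul_apply]
  exact Finset.measurable_fun_sum _ fun k _ =>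
    ((measurable_mat_apply i k).comp measurable_fst).mul
      ((measurable_mat_apply k j).comp measurable_snd)⟩

instance : MeasurableInv (LowTri p) := ⟨measurable_of_mat fun i j => by
  simp only [mat_inv]
  exact (measurable_inv_lowMat_apply i j).comp measurable_subtype_coe⟩

/-- The character `T ↦ ∏ᵢ t_{ii} ^ eᵢ`. -/
noncomputable def char (e : Fin p → ℤ) : LowTri p →* ℝ≥0∞ where
  toFun t := ENNReal.ofReal (∏ i, t.mat i i ^ e i)
  map_one' := by simp [mat_one]
  map_mul' s t := by
    rw [← ENNReal.ofReal_mul (Finset.prod_nonneg fun i _ => (zpow_pos (s.mat_diag_pos i) _).le),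
      ← Finset.prod_mul_distrib]
    simp only [mat_mul, mul_lower_diag s.mat_of_lt t.mat_of_lt, mul_zpow]

theorem char_apply (e : Fin p → ℤ) (t : LowTri p) :
    char e t = ENNReal.ofReal (∏ i, t.mat i i ^ e i) := rfl

theorem char_mul_char (e f : Fin p → ℤ) (t : LowTri p) :
    char e t * char f t = char (e + f) t := by
  rw [char_apply, char_apply, char_apply,
    ← ENNReal.ofReal_mul (Finset.prod_nonneg fun i _ => (zpow_pos (t.mat_diag_pos i) _).le),
    ← Finset.prod_mul_distrib]
  simp only [Pi.add_apply, zpow_add₀ (t.mat_diag_pos _).ne']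

theorem char_zero (t : LowTri p) : char 0 t = 1 := by simp [char_apply]

theorem char_inv (e : Fin p → ℤ) (t : LowTri p) : char e t⁻¹ = char (-e) t := by
  rw [← character_inv, eq_comm]
  apply ENNReal.eq_inv_of_mul_eq_one_left
  rw [char_mul_char, neg_add_cancel, char_zero]

theorem measurable_char (e : Fin p → ℤ) : Measurable (char e : LowTri p → ℝ≥0∞) := by
  simp only [funext (char_apply e)]
  fun_prop

/-- Lebesgue measure in the triangular coordinates. -/
noncomputable def vol (p : ℕ) : Measure (LowTri p) :=
  Measure.comap Subtype.val (volume : Measure (LowIdx p → ℝ))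

theorem measurableSet_diag_pos :
    MeasurableSet {t : LowIdx p → ℝ | ∀ i : Fin p, 0 < t ⟨(i, i), le_rfl⟩} := by
  rw [Set.ofPred_forall]
  exact MeasurableSet.iInter fun i => measurableSet_lt measurable_const (by fun_prop)

theorem measurableEmbedding_val :
    MeasurableEmbedding (Subtype.val : LowTri p → LowIdx p → ℝ) :=
  MeasurableEmbedding.subtype_coe measurableSet_diag_pos

instance : SigmaFinite (vol p) := by
  refine SigmaFinite.of_map _ (f := Subtype.val) measurableEmbedding_val.measurable.aemeasurable ?_
  have h := measurableEmbedding_val.map_comap (volume : Measure (LowIdx p → ℝ))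
  exact h ▸ inferInstance

theorem lintegral_vol (F : (LowIdx p → ℝ) → ℝ≥0∞) :
    ∫⁻ t, F t.1 ∂vol p =
      ∫⁻ t in {t : LowIdx p → ℝ | ∀ i : Fin p, 0 < t ⟨(i, i), le_rfl⟩}, F t :=
  lintegral_subtype_comap measurableSet_diag_pos F

theorem lintegral_vol_comp (f : (LowIdx p → ℝ) →ₗ[ℝ] LowIdx p → ℝ) (hf : 0 < LinearMap.det f)
    (φ : LowTri p → LowTri p) (hφ : ∀ t, (φ t).1 = f t.1)
    (hmem : ∀ t : LowIdx p → ℝ, (∀ i : Fin p, 0 < f t ⟨(i, i), le_rfl⟩) →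
      ∀ i : Fin p, 0 < t ⟨(i, i), le_rfl⟩)
    {F : LowTri p → ℝ≥0∞} (hF : Measurable F) :
    ∫⁻ t, F (φ t) ∂vol p = ENNReal.ofReal (LinearMap.det f)⁻¹ * ∫⁻ t, F t ∂vol p := by
  set F' : (LowIdx p → ℝ) → ℝ≥0∞ := Function.extend Subtype.val F 0 with hF'
  have hF'm : Measurable F' := measurableEmbedding_val.measurable_extend hF measurable_zero
  have hF't : ∀ t : LowTri p, F' t.1 = F t := fun t =>
    measurableEmbedding_val.injective.extend_apply _ _ _
  have hF'0 : ∀ t, t ∉ {t : LowIdx p → ℝ | ∀ i : Fin p, 0 < t ⟨(i, i), le_rfl⟩} → F' t = 0 :=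
    fun t ht => Function.extend_apply' _ _ _ (by rintro ⟨s, rfl⟩; exact ht s.2)
  have hset : ∀ H : (LowIdx p → ℝ) → ℝ≥0∞,
      (∀ t, t ∉ {t : LowIdx p → ℝ | ∀ i : Fin p, 0 < t ⟨(i, i), le_rfl⟩} → H t = 0) →
      ∫⁻ t, H t.1 ∂vol p = ∫⁻ t, H t := fun H hH => by
    rw [lintegral_vol, ← lintegral_indicator measurableSet_diag_pos]
    congr 1
    exact Set.indicator_eq_self.2 fun t ht => by_contra fun h => ht (hH t h)
  calc ∫⁻ t, F (φ t) ∂vol p = ∫⁻ t, F' (f t.1) ∂vol p := by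
        simp only [← hφ, hF't]
    _ = ∫⁻ t, F' (f t) := hset (fun t => F' (f t)) fun t ht => hF'0 _ fun h => ht (hmem t h)
    _ = ENNReal.ofReal (LinearMap.det f)⁻¹ * ∫⁻ t, F' t := lintegral_comp_linearMap _ f hf hF'm
    _ = _ := by rw [← hset F' hF'0]; simp only [hF't]

theorem lowMat_single_apply (r : LowIdx p) (i j : Fin p) :
    lowMat p (Pi.single r 1) i j = if i = r.1.1 ∧ j = r.1.2 then 1 else 0 := by
  by_cases h : j ≤ i
  · simp only [lowMat, Matrix.of_apply, h, dite_true, Pi.single_apply, Subtype.ext_iff,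
      Prod.ext_iff]
  · rw [lowMat_apply_of_lt _ (not_le.1 h), if_neg]
    rintro ⟨rfl, rfl⟩
    exact h r.2

theorem lowMat_add (s t : LowIdx p → ℝ) : lowMat p (s + t) = lowMat p s + lowMat p t := by
  ext i j
  by_cases h : j ≤ i <;> simp [lowMat, h]

theorem lowMat_smul (c : ℝ) (t : LowIdx p → ℝ) : lowMat p (c • t) = c • lowMat p t := by
  ext i j
  by_cases h : j ≤ i <;> simp [lowMat, h]

/-- Left multiplication by `T` in the triangular coordinates. -/
def mulLeftLin (T : LowTri p) : (LowIdx p → ℝ) →ₗ[ℝ] LowIdx p → ℝ where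
  toFun s := lowCoord (T.mat * lowMat p s)
  map_add' s t := by simp only [lowMat_add, Matrix.mul_add]; rfl
  map_smul' c t := by simp only [lowMat_smul, Matrix.mul_smul]; rfl

/-- Right multiplication by `T` in the triangular coordinates. -/
def mulRightLin (T : LowTri p) : (LowIdx p → ℝ) →ₗ[ℝ] LowIdx p → ℝ where
  toFun s := lowCoord (lowMat p s * T.mat)
  map_add' s t := by simp only [lowMat_add, Matrix.add_mul]; rfl
  map_smul' c t := by simp only [lowMat_smul, Matrix.smul_mul]; rfl

theorem mulLeftLin_single (T : LowTri p) (q r : LowIdx p) :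
    mulLeftLin T (Pi.single r 1) q = if q.1.2 = r.1.2 then T.mat q.1.1 r.1.1 else 0 := by
  simp [mulLeftLin, lowCoord, Matrix.mul_apply, lowMat_single_apply, ite_and]

theorem mulRightLin_single (T : LowTri p) (q r : LowIdx p) :
    mulRightLin T (Pi.single r 1) q = if q.1.1 = r.1.1 then T.mat r.1.2 q.1.2 else 0 := by
  simp [mulRightLin, lowCoord, Matrix.mul_apply, lowMat_single_apply, ite_and]

theorem det_mulLeftLin (T : LowTri p) :
    LinearMap.det (mulLeftLin T) = ∏ q : LowIdx p, T.mat q.1.1 q.1.1 := by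
  rw [← LinearMap.det_toMatrix', det_eq_prod_diag_of_strict _
    (fun q : LowIdx p => OrderDual.toDual q.1.1)]
  · simp [LinearMap.toMatrix'_apply, mulLeftLin_single]
  · intro q r hqr hlt
    rw [LinearMap.toMatrix'_apply, mulLeftLin_single]
    split_ifs with h
    · refine T.mat_of_lt _ _ (lt_of_le_of_ne (not_lt.1 fun h' => hlt h') fun e => hqr ?_)
      exact Subtype.ext (Prod.ext e h)
    · rfl

theorem det_mulRightLin (T : LowTri p) :
    LinearMap.det (mulRightLin T) = ∏ q : LowIdx p, T.mat q.1.2 q.1.2 := by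
  rw [← LinearMap.det_toMatrix', det_eq_prod_diag_of_strict _ (fun q : LowIdx p => q.1.2)]
  · simp [LinearMap.toMatrix'_apply, mulRightLin_single]
  · intro q r hqr hlt
    rw [LinearMap.toMatrix'_apply, mulRightLin_single]
    split_ifs with h
    · refine T.mat_of_lt _ _ (lt_of_le_of_ne (not_lt.1 hlt) fun e => hqr ?_)
      exact Subtype.ext (Prod.ext h e.symm)
    · rfl

theorem prod_lowIdx (φ : Fin p × Fin p → ℝ) :
    ∏ q : LowIdx p, φ q.1 = ∏ i, ∏ j, if j ≤ i then φ (i, j) else 1 := by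
  rw [← Fintype.prod_prod_type' (f := fun i j => if j ≤ i then φ (i, j) else 1),
    ← Finset.prod_filter]
  exact (Finset.prod_subtype _ (fun q => by simp) φ).symm

theorem prod_lowIdx_fst (φ : Fin p → ℝ) : ∏ q : LowIdx p, φ q.1.1 = ∏ i, φ i ^ ((i : ℕ) + 1) := by
  rw [prod_lowIdx fun q => φ q.1]
  refine Finset.prod_congr rfl fun i _ => ?_
  rw [← Finset.prod_filter]
  simp only [Finset.prod_const]
  congr 1
  rw [← Fin.card_Iic i]
  congr 1; ext j; simp

theorem prod_lowIdx_snd (φ : Fin p → ℝ) :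
    ∏ q : LowIdx p, φ q.1.2 = ∏ j, φ j ^ (p - (j : ℕ)) := by
  rw [prod_lowIdx fun q => φ q.2, Finset.prod_comm]
  refine Finset.prod_congr rfl fun i _ => ?_
  rw [← Finset.prod_filter]
  simp only [Finset.prod_const]
  congr 1
  rw [← Fin.card_Ici i]
  congr 1; ext j; simp

theorem ofReal_inv_prod_pow (T : LowTri p) (e : Fin p → ℕ) :
    ENNReal.ofReal (∏ i, T.mat i i ^ e i)⁻¹ = char (fun i => -(e i : ℤ)) T := by
  rw [char_apply, ← Finset.prod_inv_distrib]
  simp only [zpow_neg, zpow_natCast]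

theorem lintegral_vol_mul_left (h : LowTri p) {F : LowTri p → ℝ≥0∞} (hF : Measurable F) :
    ∫⁻ t, F (h * t) ∂vol p = char (fun i => -(((i : ℕ) + 1 : ℕ) : ℤ)) h * ∫⁻ t, F t ∂vol p := by
  rw [← ofReal_inv_prod_pow, ← prod_lowIdx_fst fun i => h.mat i i, ← det_mulLeftLin]
  refine lintegral_vol_comp (mulLeftLin h) ?_ _ (fun t => rfl) (fun t ht i => ?_) hF
  · rw [det_mulLeftLin]; exact Finset.prod_pos fun q _ => h.mat_diag_pos _
  · have := ht i
    change 0 < (h.mat * lowMat p t) i i at this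
    rw [mul_lower_diag h.mat_of_lt (fun _ _ => lowMat_apply_of_lt t), lowMat_diag] at this
    exact pos_of_mul_pos_right this (h.mat_diag_pos i).le

theorem lintegral_vol_mul_right (h : LowTri p) {F : LowTri p → ℝ≥0∞} (hF : Measurable F) :
    ∫⁻ t, F (t * h) ∂vol p = char (fun i => -((p - (i : ℕ) : ℕ) : ℤ)) h * ∫⁻ t, F t ∂vol p := by
  rw [← ofReal_inv_prod_pow, ← prod_lowIdx_snd fun i => h.mat i i, ← det_mulRightLin]
  refine lintegral_vol_comp (mulRightLin h) ?_ _ (fun t => rfl) (fun t ht i => ?_) hF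
  · rw [det_mulRightLin]; exact Finset.prod_pos fun q _ => h.mat_diag_pos _
  · have := ht i
    change 0 < (lowMat p t * h.mat) i i at this
    rw [mul_lower_diag (fun _ _ => lowMat_apply_of_lt t) h.mat_of_lt, lowMat_diag] at this
    exact pos_of_mul_pos_left this (h.mat_diag_pos i).le

theorem lintegral_mulVec (h : LowTri p) {F : (Fin p → ℝ) → ℝ≥0∞} (hF : Measurable F) :
    ∫⁻ x, F (h.mat.mulVec x) = char (fun _ => -1) h * ∫⁻ x, F x := by
  have hdet : LinearMap.det (Matrix.toLin' h.mat) = ∏ i, h.mat i i ^ 1 := by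
    rw [LinearMap.det_toLin', det_lower h.mat_of_lt]; simp
  have := lintegral_comp_linearMap volume (Matrix.toLin' h.mat)
    (by rw [LinearMap.det_toLin']; exact h.det_mat_pos) hF
  rw [hdet, ofReal_inv_prod_pow] at this
  simpa using this

theorem lintegral_mulVec_pi (n : ℕ) (h : LowTri p) {F : (Fin n → Fin p → ℝ) → ℝ≥0∞}
    (hF : Measurable F) :
    ∫⁻ X : Fin n → Fin p → ℝ, F (fun i => h.mat.mulVec (X i)) =
      char (fun _ => -(n : ℤ)) h * ∫⁻ X, F X := by
  have hdet : LinearMap.det (LinearMap.pi fun i : Fin n =>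
      (Matrix.toLin' h.mat).comp (LinearMap.proj i)) = ∏ i, h.mat i i ^ n := by
    rw [LinearMap.det_pi]
    simp [det_lower h.mat_of_lt, Finset.prod_pow]
  have := lintegral_comp_linearMap volume (LinearMap.pi fun i : Fin n =>
      (Matrix.toLin' h.mat).comp (LinearMap.proj i))
    (by rw [hdet]; exact Finset.prod_pos fun i _ => pow_pos (h.mat_diag_pos i) _) hF
  rw [hdet, ofReal_inv_prod_pow] at this
  exact this

end LowTri

/-- Triangular affine maps `x ↦ T x + a` of `ℝ^p`, as pairs `(T, a)`. -/
def TriAff (p : ℕ) := LowTri p × (Fin p → ℝ)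

namespace TriAff

/-- The map `x ↦ T x + a`. -/
def mk (T : LowTri p) (a : Fin p → ℝ) : TriAff p := (T, a)

instance : Mul (TriAff p) := ⟨fun g h => (g.1 * h.1, g.2 + g.1.mat.mulVec h.2)⟩

instance : One (TriAff p) := ⟨(1, 0)⟩

noncomputable instance : Inv (TriAff p) := ⟨fun g => (g.1⁻¹, -(g.1⁻¹).mat.mulVec g.2)⟩

theorem ext {g h : TriAff p} (h₁ : g.1 = h.1) (h₂ : g.2 = h.2) : g = h := Prod.ext h₁ h₂

theorem fst_mul (g h : TriAff p) : (g * h).1 = g.1 * h.1 := rfl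

theorem snd_mul (g h : TriAff p) : (g * h).2 = g.2 + g.1.mat.mulVec h.2 := rfl

theorem fst_one : (1 : TriAff p).1 = 1 := rfl

theorem snd_one : (1 : TriAff p).2 = 0 := rfl

theorem fst_inv (g : TriAff p) : g⁻¹.1 = g.1⁻¹ := rfl

theorem snd_inv (g : TriAff p) : g⁻¹.2 = -(g.1⁻¹).mat.mulVec g.2 := rfl

noncomputable instance : Group (TriAff p) := Group.ofLeftAxioms
  (fun a b c => ext (by simp only [fst_mul, mul_assoc]) (by
    simp only [fst_mul, snd_mul, LowTri.mat_mul, Matrix.mulVec_add, Matrix.mulVec_mulVec,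
      add_assoc]))
  (fun a => ext (by simp only [fst_mul, fst_one, one_mul])
    (by simp only [snd_mul, fst_one, snd_one, LowTri.mat_one, Matrix.one_mulVec, zero_add]))
  (fun a => ext (by simp only [fst_mul, fst_inv, fst_one, inv_mul_cancel])
    (by simp only [snd_mul, fst_inv, snd_inv, snd_one, neg_add_cancel]))

instance : MeasurableSpace (TriAff p) :=
  inferInstanceAs (MeasurableSpace (LowTri p × (Fin p → ℝ)))

theorem measurable_mulVec {α : Type*} [MeasurableSpace α] {f : α → LowTri p}
    {v : α → Fin p → ℝ} (hf : Measurable f) (hv : Measurable v) :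
    Measurable fun a => (f a).mat.mulVec (v a) := by
  refine measurable_pi_iff.2 fun i => ?_
  simp only [Matrix.mulVec, dotProduct]
  exact Finset.measurable_fun_sum _ fun k _ =>
    ((LowTri.measurable_mat_apply i k).comp hf).mul ((measurable_pi_apply k).comp hv)

theorem measurable_tri : Measurable fun g : TriAff p => g.1 := measurable_fst

theorem measurable_trans : Measurable fun g : TriAff p => g.2 := measurable_snd

instance : MeasurableMul₂ (TriAff p) := ⟨by
  have h1 : Measurable fun z : TriAff p × TriAff p => z.1.1 := measurable_tri.comp measurable_fst
  have h2 : Measurable fun z : TriAff p × TriAff p => z.2.1 := measurable_tri.comp measurable_snd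
  have h3 : Measurable fun z : TriAff p × TriAff p => z.1.2 :=
    measurable_trans.comp measurable_fst
  have h4 : Measurable fun z : TriAff p × TriAff p => z.2.2 :=
    measurable_trans.comp measurable_snd
  exact (h1.mul h2).prodMk (h3.add (measurable_mulVec h1 h4))⟩

instance : MeasurableInv (TriAff p) :=
  ⟨measurable_tri.inv.prodMk (measurable_mulVec measurable_tri.inv measurable_trans).neg⟩

/-- The linear part of a triangular affine map. -/
noncomputable def tri : TriAff p →* LowTri p where
  toFun g := g.1
  map_one' := rfl
  map_mul' _ _ := rfl

/-- The action on samples, applied to every observation. -/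
noncomputable instance (n : ℕ) : MulAction (TriAff p) (Fin n → Fin p → ℝ) where
  smul g X := fun i => g.2 + g.1.mat.mulVec (X i)
  one_smul X := by
    funext i
    change (0 : Fin p → ℝ) + (1 : LowTri p).mat.mulVec (X i) = X i
    simp [LowTri.mat_one]
  mul_smul g h X := by
    funext i
    change g.2 + g.1.mat.mulVec h.2 + (g.1 * h.1).mat.mulVec (X i) =
      g.2 + g.1.mat.mulVec (h.2 + h.1.mat.mulVec (X i))
    simp [LowTri.mat_mul, Matrix.mulVec_add, Matrix.mulVec_mulVec, add_assoc]

theorem smul_def {n : ℕ} (g : TriAff p) (X : Fin n → Fin p → ℝ) :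
    g • X = fun i => g.2 + g.1.mat.mulVec (X i) := rfl

instance (n : ℕ) : MeasurableSMul₂ (TriAff p) (Fin n → Fin p → ℝ) := ⟨by
  simp only [smul_def]
  exact measurable_pi_iff.2 fun i => (measurable_trans.comp measurable_fst).add
    (measurable_mulVec (measurable_tri.comp measurable_fst)
      ((measurable_pi_apply i).comp measurable_snd))⟩

theorem lintegral_smul (n : ℕ) (g : TriAff p) {F : (Fin n → Fin p → ℝ) → ℝ≥0∞}
    (hF : Measurable F) :
    ∫⁻ X : Fin n → Fin p → ℝ, F (g • X) = LowTri.char (fun _ => (n : ℤ)) g.1⁻¹ * ∫⁻ X, F X := by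
  have h := LowTri.lintegral_mulVec_pi n g.1
    (F := fun X => F ((fun _ => g.2) + X)) (by fun_prop)
  rw [lintegral_add_left_eq_self (μ := volume) F] at h
  rw [LowTri.char_inv]
  exact h

/-- The exponents of the density of left Haar measure in the triangular coordinates. -/
def haarExp (p : ℕ) : Fin p → ℤ := fun i => -((i : ℤ) + 2)

/-- Left Haar measure on `TriAff p`. -/
noncomputable def haar (p : ℕ) : Measure (TriAff p) :=
  ((LowTri.vol p).prod (volume : Measure (Fin p → ℝ))).withDensity
    fun g => LowTri.char (haarExp p) g.1

theorem measurable_haarDensity :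
    Measurable fun g : LowTri p × (Fin p → ℝ) => LowTri.char (haarExp p) g.1 :=
  (LowTri.measurable_char _).comp measurable_fst

instance : SigmaFinite (haar p) :=
  SigmaFinite.withDensity_of_ne_top (μ := (LowTri.vol p).prod (volume : Measure (Fin p → ℝ)))
    (Filter.Eventually.of_forall fun _ => character_ne_top _ _)

theorem lintegral_haar {F : TriAff p → ℝ≥0∞} (hF : Measurable F) :
    ∫⁻ g, F g ∂haar p =
      ∫⁻ t, LowTri.char (haarExp p) t * ∫⁻ a, F (mk t a) ∂volume ∂LowTri.vol p := by
  have h := lintegral_withDensity_eq_lintegral_mul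
    ((LowTri.vol p).prod (volume : Measure (Fin p → ℝ))) measurable_haarDensity
    (g := fun z => F z) hF
  rw [lintegral_prod _ (measurable_haarDensity.mul hF).aemeasurable] at h
  refine h.trans (lintegral_congr fun t => ?_)
  exact lintegral_const_mul' _ _ (character_ne_top _ _)

theorem measurable_lintegral_trans {F : TriAff p → ℝ≥0∞} (hF : Measurable F) :
    Measurable fun t : LowTri p => ∫⁻ a : Fin p → ℝ, F (mk t a) :=
  Measurable.lintegral_prod_right (f := fun (t : LowTri p) (a : Fin p → ℝ) => F (mk t a)) hF

theorem lintegral_haar_mul_left {F : TriAff p → ℝ≥0∞} (hF : Measurable F) (h : TriAff p) :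
    ∫⁻ g, F (h * g) ∂haar p = ∫⁻ g, F g ∂haar p := by
  rw [lintegral_haar (F := fun g => F (h * g)) (hF.comp (measurable_const_mul h)), lintegral_haar hF]
  have hin : ∀ t : LowTri p, ∫⁻ a, F (h * mk t a) ∂volume =
      LowTri.char (fun _ => -1) h.1 * ∫⁻ a, F (mk (h.1 * t) a) ∂volume := fun t => by
    have := LowTri.lintegral_mulVec h.1 (F := fun a => F (mk (h.1 * t) (h.2 + a)))
      (hF.comp (measurable_const.prodMk (by fun_prop)))
    rwa [lintegral_add_left_eq_self (μ := volume) fun a => F (mk (h.1 * t) a)] at this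
  have hc : ∀ t : LowTri p, LowTri.char (haarExp p) t =
      LowTri.char (-haarExp p) h.1 * LowTri.char (haarExp p) (h.1 * t) := fun t => by
    rw [map_mul, ← mul_assoc, LowTri.char_mul_char, neg_add_cancel, LowTri.char_zero, one_mul]
  have hm := measurable_lintegral_trans hF
  have hmc := LowTri.measurable_char (haarExp p)
  have hk := LowTri.lintegral_vol_mul_left h.1 (hmc.mul hm)
  have hpt : ∀ t : LowTri p, LowTri.char (haarExp p) t * ∫⁻ a, F (h * mk t a) ∂volume =
      LowTri.char (-haarExp p + fun _ => -1) h.1 *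
        (LowTri.char (haarExp p) (h.1 * t) * ∫⁻ a, F (mk (h.1 * t) a) ∂volume) := fun t => by
    rw [hin, hc, ← LowTri.char_mul_char]; ring
  simp only [hpt]
  rw [lintegral_const_mul' _ _ (character_ne_top _ _)]
  simp only [Pi.mul_apply] at hk
  rw [hk, ← mul_assoc, LowTri.char_mul_char]
  have : (-haarExp p + fun _ => -1) + (fun i : Fin p => -(((i : ℕ) + 1 : ℕ) : ℤ)) = 0 := by
    ext i; simp [haarExp]; ring
  rw [this, LowTri.char_zero, one_mul]

instance : (haar p).IsMulLeftInvariant := ⟨fun h => by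
  ext s hs
  rw [Measure.map_apply (measurable_const_mul h) hs,
    ← lintegral_indicator_one (measurable_const_mul h hs), ← lintegral_indicator_one hs,
    ← lintegral_haar_mul_left (measurable_one.indicator hs) h]
  rfl⟩

theorem lintegral_haar_mul_right {F : TriAff p → ℝ≥0∞} (hF : Measurable F) (h : TriAff p) :
    ∫⁻ g, F (g * h) ∂haar p =
      LowTri.char (-haarExp p + fun i : Fin p => -((p - (i : ℕ) : ℕ) : ℤ)) h.1 *
        ∫⁻ g, F g ∂haar p := by
  rw [lintegral_haar (F := fun g => F (g * h)) (hF.comp (measurable_mul_const h)), lintegral_haar hF]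
  have hin : ∀ t : LowTri p, ∫⁻ a, F (mk t a * h) ∂volume =
      ∫⁻ a, F (mk (t * h.1) a) ∂volume := fun t =>
    lintegral_add_right_eq_self (μ := volume) (fun a => F (mk (t * h.1) a)) (t.mat.mulVec h.2)
  have hpt : ∀ t : LowTri p, LowTri.char (haarExp p) t * ∫⁻ a, F (mk t a * h) ∂volume =
      LowTri.char (-haarExp p) h.1 *
        (LowTri.char (haarExp p) (t * h.1) * ∫⁻ a, F (mk (t * h.1) a) ∂volume) := fun t => by
    have hone : LowTri.char (-haarExp p) h.1 * LowTri.char (haarExp p) h.1 = 1 := by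
      rw [LowTri.char_mul_char, neg_add_cancel, LowTri.char_zero]
    rw [hin, map_mul, ← mul_assoc, mul_left_comm (LowTri.char (-haarExp p) h.1), hone, mul_one]
  have hk := LowTri.lintegral_vol_mul_right h.1
    ((LowTri.measurable_char (haarExp p)).mul (measurable_lintegral_trans hF))
  simp only [Pi.mul_apply] at hk
  simp only [hpt]
  rw [lintegral_const_mul' _ _ (character_ne_top _ _), hk, ← mul_assoc, LowTri.char_mul_char]

end TriAff

theorem intLikLT_eq_orbitIntegral (n : ℕ) (hn : p + 2 ≤ n) {f : (Fin p → ℝ) → ℝ}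
    (hf : Measurable f) (X : Fin n → Fin p → ℝ) :
    intLikLT n p f X = orbitIntegral (TriAff.haar p)
      ((LowTri.char fun _ => (n : ℤ)).comp TriAff.tri)
      (fun Y => ∏ i, ENNReal.ofReal (f (Y i))) X := by
  have hP : Measurable fun Y : Fin n → Fin p → ℝ => ∏ i, ENNReal.ofReal (f (Y i)) := by fun_prop
  have hJ : Measurable ((LowTri.char fun _ => (n : ℤ)).comp (TriAff.tri (p := p))) :=
    (LowTri.measurable_char _).comp TriAff.measurable_tri
  have hF : Measurable fun g : TriAff p => (∏ i, ENNReal.ofReal (f ((g • X) i))) *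
      (LowTri.char fun _ => (n : ℤ)).comp TriAff.tri g :=
    (hP.comp (measurable_smul_const X)).mul hJ
  rw [orbitIntegral, TriAff.lintegral_haar hF, intLikLT, ← LowTri.lintegral_vol fun t => ∫⁻ a : Fin p → ℝ,
      (∏ i, ENNReal.ofReal (f (a + (lowMat p t).mulVec (X i)))) *
        ENNReal.ofReal (∏ i : Fin p, t ⟨(i, i), le_rfl⟩ ^ (n - (i : ℕ) - 2))]
  refine lintegral_congr fun t => ?_
  have hexp : ENNReal.ofReal (∏ i : Fin p, t.1 ⟨(i, i), le_rfl⟩ ^ (n - (i : ℕ) - 2)) =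
      LowTri.char (fun _ => (n : ℤ)) t * LowTri.char (TriAff.haarExp p) t := by
    rw [LowTri.char_mul_char, LowTri.char_apply]
    congr 1
    refine Finset.prod_congr rfl fun i _ => ?_
    rw [LowTri.mat, lowMat_diag, ← zpow_natCast]
    congr 1
    simp only [Pi.add_apply, TriAff.haarExp]
    omega
  rw [hexp, ← lintegral_const_mul' _ _ (character_ne_top _ _)]
  refine lintegral_congr fun a => ?_
  change (∏ i, ENNReal.ofReal (f (a + t.mat.mulVec (X i)))) * _ =
    _ * ((∏ i, ENNReal.ofReal (f (a + t.mat.mulVec (X i)))) * LowTri.char (fun _ => (n : ℤ)) t)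
  ring

end LowerTriangular

theorem lintegral_prod_ofReal_ne_top {α : Type*} [MeasurableSpace α] (μ : Measure α)
    [SigmaFinite μ] (n : ℕ) {f : α → ℝ} (hf : Measurable f)
    (hf0 : ∀ x, 0 ≤ f x) (hfin : ∫⁻ x, ENNReal.ofReal (f x) ∂μ ≠ ∞) :
    ∫⁻ X : Fin n → α, ∏ i, ENNReal.ofReal (f (X i)) ∂Measure.pi (fun _ => μ) ≠ ∞ := by
  have hint : Integrable f μ :=
    (lintegral_ofReal_ne_top_iff_integrable hf.aestronglyMeasurable
      (Filter.Eventually.of_forall hf0)).1 hfin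
  have hprod : Integrable (fun X : Fin n → α => ∏ i, f (X i)) (Measure.pi fun _ => μ) :=
    Integrable.fintype_prod (f := fun _ => f) fun _ => hint
  simp only [← ENNReal.ofReal_prod_of_nonneg fun i _ => hf0 _]
  exact hprod.lintegral_lt_top.ne

/-- Proposition 3 of the paper: the region
`R* = {X : M_{θ₁}(X) > k' M₀(X)}` given by the ratio of the integrated likelihoods is the most
powerful test of `f₀` against `f₁` among regions invariant under the group `ℝ^p × LT(p)` of
lower triangular transformations `X ↦ 1ₙ a' + X T'` (rows `xᵢ ↦ a + T xᵢ`, `T` lower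
triangular with positive diagonal). -/
theorem most_powerful_triangular_invariant_test (p n : ℕ) (hp : 1 ≤ p) (hn : p + 2 ≤ n)
    (θ₁ k' : ℝ) (hθ₁ : 0 < θ₁) (hk' : 0 < k')
    (f0 f1 : (Fin p → ℝ) → ℝ)
    (hf0m : Measurable f0) (hf1m : Measurable f1)
    (hf0nn : ∀ x, 0 ≤ f0 x) (hf1nn : ∀ x, 0 ≤ f1 x)
    (hf0d : (∫⁻ x : Fin p → ℝ, ENNReal.ofReal (f0 x)) = 1)
    (hf1d : (∫⁻ x : Fin p → ℝ, ENNReal.ofReal (f1 x)) = 1)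
    (hfin : ∀ᵐ X : Fin n → Fin p → ℝ,
      intLikLT n p f0 X < ⊤ ∧ intLikLT n p f1 X < ⊤ ∧ 0 < intLikLT n p f0 X) :
    ∀ R : Set (Fin n → Fin p → ℝ), MeasurableSet R →
      (∀ (a : Fin p → ℝ) (T : Matrix (Fin p) (Fin p) ℝ),
        (∀ i j : Fin p, i < j → T i j = 0) → (∀ i : Fin p, 0 < T i i) →
        ∀ X : Fin n → Fin p → ℝ, X ∈ R ↔ (fun i => a + T.mulVec (X i)) ∈ R) →
      (∫⁻ X in R, ∏ i, ENNReal.ofReal (f0 (X i))) ≤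
        (∫⁻ X in {X : Fin n → Fin p → ℝ |
            ENNReal.ofReal k' * intLikLT n p f0 X < intLikLT n p f1 X},
          ∏ i, ENNReal.ofReal (f0 (X i))) →
      (∫⁻ X in R, ∏ i, ENNReal.ofReal (f1 (X i))) ≤
        (∫⁻ X in {X : Fin n → Fin p → ℝ |
            ENNReal.ofReal k' * intLikLT n p f0 X < intLikLT n p f1 X},
          ∏ i, ENNReal.ofReal (f1 (X i))) := by
  intro R hR hinv
  simp only [intLikLT_eq_orbitIntegral n hn hf0m, intLikLT_eq_orbitIntegral n hn hf1m] at hfin ⊢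
  refine neyman_pearson_invariant (TriAff.haar p) volume
    ((LowTri.char fun _ => (n : ℤ)).comp TriAff.tri)
    ((LowTri.char (-TriAff.haarExp p + fun i : Fin p => -((p - (i : ℕ) : ℕ) : ℤ))).comp TriAff.tri)
    ((LowTri.measurable_char _).comp TriAff.measurable_tri)
    ((LowTri.measurable_char _).comp TriAff.measurable_tri)
    (fun F hF h => TriAff.lintegral_haar_mul_right hF h)
    (fun F hF g => TriAff.lintegral_smul n g hF) (by fun_prop) (by fun_prop)
    (lintegral_prod_ofReal_ne_top volume n hf0m hf0nn (by simp [hf0d]))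
    (hfin.mono fun X hX => ⟨hX.2.2.ne', hX.1.ne⟩) (ENNReal.ofReal k') hR fun g X => ?_
  exact (hinv g.2 g.1.mat g.1.mat_of_lt g.1.mat_diag_pos X).symm
end

section
/- Let p ≥ 1 and n ≥ p + 2. Then there exists a constant c > 0, depending only on n and p, such that for every measurable set D of p×p real symmetric matrices: ∫_{ { B ∈ ℝ^{p×p} : n·B′B ∈ D } } exp( −(n/2)·tr(B′B) ) · |det B|^{n−p−1} dB = c · ∫_{D ∩ PD(p)} exp( −(1/2)·tr C ) · (det C)^{(n−p−2)/2} dC, where dB is Lebesgue measure on ℝ^{p×p}, PD(p) is the set of p×p positive definite symmetric matrices, and dC = ∏_{i≥j} dc_{ij} is Lebesgue measure on the space of symmetric matrices. -/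
open MeasureTheory
open scoped ENNReal Matrix

/-- The symmetric matrix built from its on-or-below-diagonal entries. -/
def symMat (p : ℕ) (c : LowIdx p → ℝ) : Matrix (Fin p) (Fin p) ℝ :=
  Matrix.of fun i j =>
    if h : j ≤ i then c ⟨(i, j), h⟩ else c ⟨(j, i), (not_le.mp h).le⟩

/-- The on-or-below-diagonal coordinates of a matrix. -/
def lowCoords (p : ℕ) (M : Matrix (Fin p) (Fin p) ℝ) : LowIdx p → ℝ := fun q => M q.1.1 q.1.2

/-- A multiplicative real-valued function on square matrices is a power of the determinant
as soon as it is so on diagonal matrices. -/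
theorem monoidHom_matrix_eq_det_pow {ι : Type*} [Fintype ι] [DecidableEq ι]
    (φ : Matrix ι ι ℝ →* ℝ) (m : ℕ)
    (hφ : ∀ d : ι → ℝ, φ (Matrix.diagonal d) = (∏ i, d i) ^ m)
    (A : Matrix ι ι ℝ) (hA : A.det ≠ 0) : φ A = A.det ^ m := by
  refine Matrix.diagonal_transvection_induction_of_det_ne_zero (fun A => φ A = A.det ^ m) A hA
    (fun d _ => by rw [hφ, Matrix.det_diagonal]) ?_
    (fun A B _ _ h₁ h₂ => by rw [map_mul, h₁, h₂, Matrix.det_mul, mul_pow])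
  rintro ⟨i, j, hij, c⟩
  have hunit : ∀ x, φ (Matrix.transvection i j x) ≠ 0 := fun x h => by
    have h1 : φ (Matrix.transvection i j x * Matrix.transvection i j (-x)) = 1 := by
      rw [Matrix.transvection_mul_transvection_same i j hij]; simp
    rw [map_mul, h, zero_mul] at h1
    exact zero_ne_one h1
  set d : ι → ℝ := Function.update 1 i 2 with hd
  have hconj : Matrix.diagonal d * Matrix.transvection i j c =
      Matrix.transvection i j (c + c) * Matrix.diagonal d := by
    ext a b
    simp only [Matrix.diagonal_mul, Matrix.mul_diagonal, Matrix.transvection, Matrix.add_apply,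
      Matrix.one_apply, Matrix.single_apply, hd, Function.update_apply, Pi.one_apply]
    split_ifs <;> grind
  have hd0 : φ (Matrix.diagonal d) ≠ 0 := by
    rw [hφ]
    refine pow_ne_zero _ (Finset.prod_ne_zero_iff.2 fun a _ => ?_)
    simp only [hd, Function.update_apply]; split_ifs <;> simp
  have h := congrArg φ hconj
  rw [← Matrix.transvection_mul_transvection_same i j hij] at h
  simp only [map_mul] at h
  have h1 : φ (Matrix.transvection i j c) = 1 := by
    have h2 : φ (Matrix.transvection i j c) * φ (Matrix.diagonal d) *
        (φ (Matrix.transvection i j c) - 1) = 0 := by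
      linear_combination -h
    simpa [hunit c, hd0, sub_eq_zero] using h2
  simpa [Matrix.TransvectionStruct.toMatrix, Matrix.det_transvection_of_ne i j hij] using h1

theorem LinearMap.det_eq_prod_of_apply_eq_mul {ι : Type*} [Fintype ι] [DecidableEq ι]
    (L : (ι → ℝ) →ₗ[ℝ] ι → ℝ) (d : ι → ℝ) (h : ∀ x i, L x i = d i * x i) :
    LinearMap.det L = ∏ i, d i := by
  have : L = Matrix.toLin' (Matrix.diagonal d) := by
    refine LinearMap.ext fun x => funext fun i => ?_
    simp [h, Matrix.mulVec_diagonal]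
  rw [this, LinearMap.det_toLin', Matrix.det_diagonal]

theorem symMat_apply_le {p : ℕ} (c : LowIdx p → ℝ) {i j : Fin p} (h : j ≤ i) :
    symMat p c i j = c ⟨(i, j), h⟩ := by
  simp [symMat, h]

theorem symMat_isSymm {p : ℕ} (c : LowIdx p → ℝ) : (symMat p c).IsSymm := by
  ext i j
  simp only [Matrix.transpose_apply, symMat, Matrix.of_apply]
  split_ifs with h₁ h₂ h₂
  · have := le_antisymm h₁ h₂; subst this; rfl
  · rfl
  · rfl
  · exact absurd (le_total i j) (by tauto)

theorem lowCoords_symMat {p : ℕ} (c : LowIdx p → ℝ) : lowCoords p (symMat p c) = c := by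
  funext ⟨⟨i, j⟩, h⟩
  exact symMat_apply_le c h

theorem symMat_lowCoords {p : ℕ} {M : Matrix (Fin p) (Fin p) ℝ} (hM : M.IsSymm) :
    symMat p (lowCoords p M) = M := by
  ext i j
  simp only [symMat, lowCoords, Matrix.of_apply]
  split_ifs
  · rfl
  · exact hM.apply i j

/-- The congruence action `C ↦ A' C A` on symmetric matrices, in lower-triangular coordinates. -/
def congrAct (p : ℕ) (A : Matrix (Fin p) (Fin p) ℝ) : (LowIdx p → ℝ) →ₗ[ℝ] LowIdx p → ℝ where
  toFun c := lowCoords p (Aᵀ * symMat p c * A)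
  map_add' c d := by
    have : symMat p (c + d) = symMat p c + symMat p d := by
      ext i j; simp only [symMat, Matrix.of_apply, Matrix.add_apply]; split_ifs <;> rfl
    rw [this, Matrix.mul_add, Matrix.add_mul]; rfl
  map_smul' r c := by
    have : symMat p (r • c) = r • symMat p c := by
      ext i j; simp only [symMat, Matrix.of_apply, Matrix.smul_apply]; split_ifs <;> rfl
    rw [this, Matrix.mul_smul, Matrix.smul_mul]; rfl

theorem congrAct_apply {p : ℕ} (A : Matrix (Fin p) (Fin p) ℝ) (c : LowIdx p → ℝ) :
    congrAct p A c = lowCoords p (Aᵀ * symMat p c * A) := rfl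

theorem symMat_congrAct {p : ℕ} (A : Matrix (Fin p) (Fin p) ℝ) (c : LowIdx p → ℝ) :
    symMat p (congrAct p A c) = Aᵀ * symMat p c * A := by
  rw [congrAct_apply, symMat_lowCoords]
  rw [Matrix.IsSymm, Matrix.transpose_mul, Matrix.transpose_mul, Matrix.transpose_transpose,
    (symMat_isSymm c).eq, Matrix.mul_assoc]

theorem congrAct_mul {p : ℕ} (A B : Matrix (Fin p) (Fin p) ℝ) :
    congrAct p (A * B) = congrAct p B ∘ₗ congrAct p A := by
  refine LinearMap.ext fun c => ?_
  simp only [LinearMap.comp_apply]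
  rw [congrAct_apply B, symMat_congrAct, congrAct_apply, Matrix.transpose_mul]
  simp only [Matrix.mul_assoc]

theorem congrAct_one (p : ℕ) : congrAct p 1 = LinearMap.id := by
  refine LinearMap.ext fun c => ?_
  simp [congrAct_apply, lowCoords_symMat]

theorem prod_lowIdx_mul {p : ℕ} (d : Fin p → ℝ) :
    ∏ q : LowIdx p, d q.1.1 * d q.1.2 = (∏ i, d i) ^ (p + 1) := by
  have hsum : ∀ f : Fin p × Fin p → ℝ,
      ∏ q : LowIdx p, f q.1 = ∏ i, ∏ j, if j ≤ i then f (i, j) else 1 := fun f => by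
    rw [← Fintype.prod_prod_type' (fun i j => if j ≤ i then f (i, j) else 1),
      ← Finset.prod_filter (fun q : Fin p × Fin p => q.2 ≤ q.1) f]
    exact (Finset.prod_subtype _ (by simp) f).symm
  rw [Finset.prod_mul_distrib, hsum fun q => d q.1, hsum fun q => d q.2,
    Finset.prod_comm (f := fun i j => if j ≤ i then d j else 1), ← Finset.prod_mul_distrib,
    ← Finset.prod_pow]
  refine Finset.prod_congr rfl fun i _ => ?_
  rw [← Finset.prod_mul_distrib]
  have : ∀ j, ((if j ≤ i then d i else 1) * if i ≤ j then d i else 1) =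
      d i * if i = j then d i else 1 := fun j => by
    rcases lt_trichotomy i j with h | h | h
    · simp [h.le, h.not_ge, h.ne]
    · simp [h]
    · simp [h.le, h.not_ge, h.ne']
  simp only [this, Finset.prod_mul_distrib, Finset.prod_ite_eq, Finset.mem_univ, if_true]
  simp [pow_succ]

theorem det_congrAct {p : ℕ} {A : Matrix (Fin p) (Fin p) ℝ} (hA : A.det ≠ 0) :
    LinearMap.det (congrAct p A) = A.det ^ (p + 1) := by
  refine monoidHom_matrix_eq_det_pow
    ⟨⟨fun A => LinearMap.det (congrAct p A), by simp [congrAct_one]⟩, fun A B => ?_⟩ _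
    (fun d => ?_) A hA
  · simp only [congrAct_mul]
    rw [LinearMap.det_comp, mul_comm]
  · rw [← prod_lowIdx_mul]
    refine LinearMap.det_eq_prod_of_apply_eq_mul _ _ fun c q => ?_
    obtain ⟨⟨i, j⟩, h⟩ := q
    simp only [congrAct_apply, lowCoords, Matrix.diagonal_transpose, Matrix.diagonal_mul,
      Matrix.mul_diagonal, symMat_apply_le c h]
    ring

/-- Left multiplication by `A` on square matrices viewed as functions. -/
def leftMul (p : ℕ) (A : Matrix (Fin p) (Fin p) ℝ) :
    (Fin p → Fin p → ℝ) →ₗ[ℝ] Fin p → Fin p → ℝ where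
  toFun B i j := (A * Matrix.of B) i j
  map_add' B C := by ext i j; exact congrFun₂ (Matrix.mul_add A (Matrix.of B) (Matrix.of C)) i j
  map_smul' r B := by ext i j; exact congrFun₂ (Matrix.mul_smul A r (Matrix.of B)) i j

/-- Right multiplication by `A` on square matrices viewed as functions. -/
def rightMul (p : ℕ) (A : Matrix (Fin p) (Fin p) ℝ) :
    (Fin p → Fin p → ℝ) →ₗ[ℝ] Fin p → Fin p → ℝ where
  toFun B i j := (Matrix.of B * A) i j
  map_add' B C := by ext i j; exact congrFun₂ (Matrix.add_mul (Matrix.of B) (Matrix.of C) A) i j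
  map_smul' r B := by ext i j; exact congrFun₂ (Matrix.smul_mul r (Matrix.of B) A) i j

theorem of_leftMul {p : ℕ} (A : Matrix (Fin p) (Fin p) ℝ) (B : Fin p → Fin p → ℝ) :
    Matrix.of (leftMul p A B) = A * Matrix.of B := rfl

theorem of_rightMul {p : ℕ} (A : Matrix (Fin p) (Fin p) ℝ) (B : Fin p → Fin p → ℝ) :
    Matrix.of (rightMul p A B) = Matrix.of B * A := rfl

theorem det_leftMul {p : ℕ} {A : Matrix (Fin p) (Fin p) ℝ} (hA : A.det ≠ 0) :
    LinearMap.det (leftMul p A) = A.det ^ p := by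
  refine monoidHom_matrix_eq_det_pow
    ⟨⟨fun A => LinearMap.det (leftMul p A), ?_⟩, fun A B => ?_⟩ _ (fun d => ?_) A hA
  · have : leftMul p 1 = LinearMap.id :=
      LinearMap.ext fun B => Matrix.of.injective (by rw [of_leftMul, Matrix.one_mul]; rfl)
    rw [this, LinearMap.det_id]
  · have : leftMul p (A * B) = leftMul p A ∘ₗ leftMul p B :=
      LinearMap.ext fun C => Matrix.of.injective (by
        rw [of_leftMul, LinearMap.comp_apply, of_leftMul, of_leftMul, Matrix.mul_assoc])
    simp only [this, LinearMap.det_comp]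
  · have : leftMul p (Matrix.diagonal d) = LinearMap.pi fun i =>
        ((d i) • (LinearMap.id : (Fin p → ℝ) →ₗ[ℝ] Fin p → ℝ)).comp (LinearMap.proj i) := by
      refine LinearMap.ext fun B => funext fun i => funext fun j => ?_
      exact Matrix.diagonal_mul d (Matrix.of B) i j
    change LinearMap.det (leftMul p (Matrix.diagonal d)) = _
    rw [this, LinearMap.det_pi]
    simp [Finset.prod_pow]

theorem det_rightMul {p : ℕ} (A : Matrix (Fin p) (Fin p) ℝ) :
    LinearMap.det (rightMul p A) = A.det ^ p := by
  have : rightMul p A = LinearMap.pi fun i => (Matrix.toLin' Aᵀ).comp (LinearMap.proj i) := by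
    refine LinearMap.ext fun B => funext fun i => ?_
    simp only [LinearMap.pi_apply, LinearMap.comp_apply, LinearMap.proj_apply,
      Matrix.toLin'_apply, Matrix.mulVec_transpose]
    rfl
  rw [this, LinearMap.det_pi]
  simp

theorem lintegral_comp_linearMap_mul {E : Type*} [NormedAddCommGroup E] [NormedSpace ℝ E]
    [MeasurableSpace E] [BorelSpace E] [FiniteDimensional ℝ E] (μ : Measure E)
    [μ.IsAddHaarMeasure] {L : E →ₗ[ℝ] E} (hL : LinearMap.det L ≠ 0) {w F : E → ℝ≥0∞}
    (hw : Measurable w) (hF : Measurable F)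
    (h : ∀ x, w x = ENNReal.ofReal |LinearMap.det L| * w (L x)) :
    ∫⁻ x, F (L x) * w x ∂μ = ∫⁻ x, F x * w x ∂μ := by
  have hLm : Measurable L := L.continuous_of_finiteDimensional.measurable
  have hFw : Measurable fun x => F x * w x := hF.mul hw
  calc ∫⁻ x, F (L x) * w x ∂μ
      = ENNReal.ofReal |LinearMap.det L| * ∫⁻ x, F (L x) * w (L x) ∂μ := by
        rw [← lintegral_const_mul (f := fun x => F (L x) * w (L x)) _ (hFw.comp hLm)]
        refine lintegral_congr fun x => ?_
        rw [h x]; ring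
    _ = ENNReal.ofReal |LinearMap.det L| * ∫⁻ x, F x * w x ∂(Measure.map L μ) := by
        rw [lintegral_map hFw hLm]
    _ = ∫⁻ x, F x * w x ∂μ := by
        rw [Measure.map_linearMap_addHaar_eq_smul_addHaar μ hL, lintegral_smul_measure,
          smul_eq_mul, ← mul_assoc, ← ENNReal.ofReal_mul (abs_nonneg _), ← abs_mul,
          mul_inv_cancel₀ hL]
        simp

/-- The density `|det B|⁻ᵖ` of the Haar measure on invertible matrices. -/
noncomputable def matWeight (p : ℕ) (B : Fin p → Fin p → ℝ) : ℝ≥0∞ :=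
  ENNReal.ofReal (|(Matrix.of B).det|⁻¹ ^ p)

/-- The density `(det C)^{-(p+1)/2}` of the invariant measure on positive definite matrices. -/
noncomputable def symWeight (p : ℕ) : (LowIdx p → ℝ) → ℝ≥0∞ :=
  Set.indicator {C | (symMat p C).PosDef} fun C =>
    ENNReal.ofReal ((symMat p C).det ^ (-((p : ℝ) + 1) / 2))

/-- The lower-triangular coordinates of `B'B`. -/
def gramCoords (p : ℕ) (B : Fin p → Fin p → ℝ) : LowIdx p → ℝ :=
  lowCoords p ((Matrix.of B)ᵀ * Matrix.of B)

theorem continuous_symMat (p : ℕ) : Continuous (symMat p) := by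
  refine continuous_matrix fun i j => ?_
  simp only [symMat, Matrix.of_apply]
  split_ifs <;> fun_prop

theorem continuous_lowCoords (p : ℕ) : Continuous (lowCoords p) := by
  unfold lowCoords
  fun_prop

theorem continuous_matrix_of (p : ℕ) :
    Continuous (Matrix.of : (Fin p → Fin p → ℝ) → Matrix (Fin p) (Fin p) ℝ) := continuous_id

theorem continuous_gramCoords (p : ℕ) : Continuous (gramCoords p) := by
  have := continuous_matrix_of p
  exact (continuous_lowCoords p).comp (this.matrix_transpose.matrix_mul this)

theorem isOpen_setOf_posDef (p : ℕ) : IsOpen {C : LowIdx p → ℝ | (symMat p C).PosDef} := by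
  have hset : {C : LowIdx p → ℝ | (symMat p C).PosDef} =
      {C | ∀ x ∈ Metric.sphere (0 : Fin p → ℝ) 1, 0 < x ⬝ᵥ symMat p C *ᵥ x} := by
    ext C
    refine ⟨fun h x hx => ?_, fun h => ?_⟩
    · exact h.dotProduct_mulVec_pos (by rintro rfl; simp at hx)
    · refine .of_dotProduct_mulVec_pos ?_ fun x hx => ?_
      · exact symMat_isSymm C
      · have hn : 0 < ‖x‖ := norm_pos_iff.2 hx
        have := h (‖x‖⁻¹ • x) (by simp [norm_smul, hn.ne'])
        rw [Matrix.mulVec_smul, dotProduct_smul, smul_dotProduct, smul_smul, smul_eq_mul] at this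
        simpa using pos_of_mul_pos_right this (by positivity)
  rw [hset, isOpen_iff_eventually]
  intro C hC
  refine (isCompact_sphere (0 : Fin p → ℝ) 1).eventually_forall_of_forall_eventually fun x hx => ?_
  have hcont : Continuous fun z : (LowIdx p → ℝ) × (Fin p → ℝ) =>
      z.2 ⬝ᵥ symMat p z.1 *ᵥ z.2 :=
    continuous_snd.dotProduct
      (((continuous_symMat p).comp continuous_fst).matrix_mulVec continuous_snd)
  exact (isOpen_lt continuous_const hcont).mem_nhds (hC x hx)

theorem measurable_matWeight (p : ℕ) : Measurable (matWeight p) := by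
  have : Measurable fun B : Fin p → Fin p → ℝ => (Matrix.of B).det :=
    (continuous_matrix_of p).matrix_det.measurable
  unfold matWeight
  fun_prop

theorem measurable_symWeight (p : ℕ) : Measurable (symWeight p) := by
  have : Measurable fun C : LowIdx p → ℝ => (symMat p C).det :=
    (continuous_symMat p).matrix_det.measurable
  refine Measurable.indicator ?_ (isOpen_setOf_posDef p).measurableSet
  fun_prop

theorem matWeight_of_det_eq_zero {p : ℕ} (hp : 1 ≤ p) {B : Fin p → Fin p → ℝ}
    (hB : (Matrix.of B).det = 0) : matWeight p B = 0 := by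
  have : p ≠ 0 := by omega
  simp [matWeight, hB, this]

theorem symWeight_of_not_posDef {p : ℕ} {C : LowIdx p → ℝ} (hC : ¬ (symMat p C).PosDef) :
    symWeight p C = 0 := 
  Set.indicator_of_notMem (s := {C | (symMat p C).PosDef}) hC _

theorem symWeight_of_posDef {p : ℕ} {C : LowIdx p → ℝ} (hC : (symMat p C).PosDef) :
    symWeight p C = ENNReal.ofReal ((symMat p C).det ^ (-((p : ℝ) + 1) / 2)) :=
  Set.indicator_of_mem (s := {C | (symMat p C).PosDef}) hC _

theorem lintegral_leftMul {p : ℕ} {A : Matrix (Fin p) (Fin p) ℝ} (hA : A.det ≠ 0)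
    {F : (Fin p → Fin p → ℝ) → ℝ≥0∞} (hF : Measurable F) :
    ∫⁻ B, F (leftMul p A B) * matWeight p B = ∫⁻ B, F B * matWeight p B := by
  refine lintegral_comp_linearMap_mul _ (by rw [det_leftMul hA]; exact pow_ne_zero _ hA)
    (measurable_matWeight p) hF fun B => ?_
  rw [det_leftMul hA, matWeight, matWeight, of_leftMul, Matrix.det_mul,
    ← ENNReal.ofReal_mul (abs_nonneg _), abs_pow, ← mul_pow, abs_mul, mul_inv,
    mul_inv_cancel_left₀ (abs_ne_zero.2 hA)]

theorem lintegral_rightMul {p : ℕ} {A : Matrix (Fin p) (Fin p) ℝ} (hA : A.det ≠ 0)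
    {F : (Fin p → Fin p → ℝ) → ℝ≥0∞} (hF : Measurable F) :
    ∫⁻ B, F (rightMul p A B) * matWeight p B = ∫⁻ B, F B * matWeight p B := by
  refine lintegral_comp_linearMap_mul _ (by rw [det_rightMul]; exact pow_ne_zero _ hA)
    (measurable_matWeight p) hF fun B => ?_
  rw [det_rightMul, matWeight, matWeight, of_rightMul, Matrix.det_mul, mul_comm (Matrix.det _),
    ← ENNReal.ofReal_mul (abs_nonneg _), abs_pow, ← mul_pow, abs_mul, mul_inv,
    mul_inv_cancel_left₀ (abs_ne_zero.2 hA)]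

theorem posDef_congrAct_iff {p : ℕ} {A : Matrix (Fin p) (Fin p) ℝ} (hA : A.det ≠ 0)
    (C : LowIdx p → ℝ) : (symMat p (congrAct p A C)).PosDef ↔ (symMat p C).PosDef := by
  rw [symMat_congrAct]
  have hU : IsUnit A := (Matrix.isUnit_iff_isUnit_det A).2 hA.isUnit
  exact Matrix.IsUnit.posDef_star_left_conjugate_iff hU

theorem lintegral_congrAct {p : ℕ} {A : Matrix (Fin p) (Fin p) ℝ} (hA : A.det ≠ 0)
    {F : (LowIdx p → ℝ) → ℝ≥0∞} (hF : Measurable F) :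
    ∫⁻ C, F (congrAct p A C) * symWeight p C = ∫⁻ C, F C * symWeight p C := by
  refine lintegral_comp_linearMap_mul _ (by rw [det_congrAct hA]; exact pow_ne_zero _ hA)
    (measurable_symWeight p) hF fun C => ?_
  by_cases hC : (symMat p C).PosDef
  · rw [symWeight_of_posDef hC, symWeight_of_posDef ((posDef_congrAct_iff hA C).2 hC),
      det_congrAct hA, symMat_congrAct, Matrix.det_mul, Matrix.det_mul, Matrix.det_transpose,
      ← ENNReal.ofReal_mul (abs_nonneg _)]
    congr 1
    have hA' : 0 < |A.det| := abs_pos.2 hA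
    have hsq : A.det * (symMat p C).det * A.det = |A.det| ^ (2 : ℝ) * (symMat p C).det := by
      rw [Real.rpow_two, sq_abs]; ring
    rw [hsq, Real.mul_rpow (by positivity) hC.det_pos.le, ← Real.rpow_mul hA'.le, ← mul_assoc,
      abs_pow, ← Real.rpow_natCast, ← Real.rpow_add hA']
    have : ((p + 1 : ℕ) : ℝ) + 2 * (-((p : ℝ) + 1) / 2) = 0 := by push_cast; ring
    rw [this, Real.rpow_zero, one_mul]
  · rw [symWeight_of_not_posDef hC,
      symWeight_of_not_posDef (mt (posDef_congrAct_iff hA C).1 hC), mul_zero]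

theorem Matrix.continuousAt_inv_of_det_ne_zero {ι : Type*} [Fintype ι] [DecidableEq ι]
    {M : Matrix ι ι ℝ} (hM : M.det ≠ 0) : ContinuousAt (fun N : Matrix ι ι ℝ => N⁻¹) M := by
  refine continuousAt_matrix_inv M ?_
  rw [Ring.inverse_eq_inv']
  exact continuousAt_inv₀ hM

theorem measurable_inv_apply {p : ℕ} {α : Type*} [MeasurableSpace α]
    {M : α → Matrix (Fin p) (Fin p) ℝ} (hM : ∀ i j, Measurable fun a => M a i j) (i j : Fin p) :
    Measurable fun a => (M a)⁻¹ i j := by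
  have hM' : Measurable fun a => (fun i j => M a i j : Fin p → Fin p → ℝ) :=
    measurable_pi_lambda _ fun i => measurable_pi_lambda _ fun j => hM i j
  have h1 : Measurable fun B : Fin p → Fin p → ℝ => (Matrix.of B).det :=
    (continuous_matrix_of p).matrix_det.measurable
  have h2 : Measurable fun B : Fin p → Fin p → ℝ => (Matrix.of B).adjugate i j :=
    ((continuous_matrix_of p).matrix_adjugate.matrix_elem i j).measurable
  simp only [Matrix.inv_def, Ring.inverse_eq_inv', Matrix.smul_apply]
  exact (h1.inv.comp hM').mul (h2.comp hM')

theorem measurable_congrAct_apply {p : ℕ} {α : Type*} [MeasurableSpace α]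
    {M : α → Matrix (Fin p) (Fin p) ℝ} (hM : ∀ i j, Measurable fun a => M a i j)
    {C : α → LowIdx p → ℝ} (hC : Measurable C) : Measurable fun a => congrAct p (M a) (C a) := by
  have hS : ∀ i j, Measurable fun a => symMat p (C a) i j := fun i j =>
    ((continuous_symMat p).matrix_elem i j).measurable.comp hC
  refine measurable_pi_lambda _ fun q => ?_
  simp only [congrAct_apply, lowCoords, Matrix.mul_apply, Matrix.transpose_apply]
  fun_prop

theorem gramCoords_eq_congrAct {p : ℕ} (B : Fin p → Fin p → ℝ) :
    gramCoords p B = congrAct p (Matrix.of B) (lowCoords p 1) := by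
  rw [gramCoords, congrAct_apply, symMat_lowCoords Matrix.isSymm_one, Matrix.mul_one]

open scoped MatrixOrder Matrix.Norms.L2Operator in
theorem Matrix.PosDef.exists_eq_transpose_mul_self {ι : Type*} [Fintype ι] [DecidableEq ι]
    {M : Matrix ι ι ℝ} (hM : M.PosDef) : ∃ S : Matrix ι ι ℝ, S.det ≠ 0 ∧ M = Sᵀ * S := by
  obtain ⟨S, hS⟩ := CStarAlgebra.nonneg_iff_eq_star_mul_self.mp hM.posSemidef.nonneg
  have hS' : M = Sᵀ * S := hS
  refine ⟨S, fun h => hM.det_pos.ne' ?_, hS'⟩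
  rw [hS', Matrix.det_mul, h, mul_zero]

/-- Two integrals over the positive definite cone and over invertible matrices agree up to
constants, by uniqueness of the measure on the cone invariant under congruence. -/
theorem lintegral_symWeight_mul_eq_lintegral_gramCoords {p : ℕ} (hp : 1 ≤ p)
    {k f : (LowIdx p → ℝ) → ℝ≥0∞} (hk : Measurable k) (hf : Measurable f) :
    (∫⁻ B, k (congrAct p (Matrix.of B)⁻¹ (lowCoords p 1)) * matWeight p B) *
        ∫⁻ C, f C * symWeight p C =
      (∫⁻ C, k C * symWeight p C) * ∫⁻ B, f (gramCoords p B) * matWeight p B := by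
  have hw := measurable_matWeight p
  have hv := measurable_symWeight p
  have hof : ∀ i j, Measurable fun B : Fin p → Fin p → ℝ => (Matrix.of B) i j := fun i j =>
    ((continuous_matrix_of p).matrix_elem i j).measurable
  have hk1 : Measurable fun B : Fin p → Fin p → ℝ =>
      k (congrAct p (Matrix.of B)⁻¹ (lowCoords p 1)) :=
    hk.comp (measurable_congrAct_apply (measurable_inv_apply hof) measurable_const)
  have hk2 : Measurable fun z : (LowIdx p → ℝ) × (Fin p → Fin p → ℝ) =>
      k (congrAct p (Matrix.of z.2)⁻¹ z.1) :=
    hk.comp (measurable_congrAct_apply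
      (measurable_inv_apply fun i j => (hof i j).comp measurable_snd) measurable_fst)
  have hf2 : Measurable fun z : (LowIdx p → ℝ) × (Fin p → Fin p → ℝ) =>
      f (congrAct p (Matrix.of z.2) z.1) :=
    hf.comp (measurable_congrAct_apply (fun i j => (hof i j).comp measurable_snd) measurable_fst)
  have hfg : Measurable fun B => f (gramCoords p B) :=
    hf.comp (continuous_gramCoords p).measurable
  have hkw : ∀ C, Measurable fun B : Fin p → Fin p → ℝ =>
      k (congrAct p (Matrix.of B)⁻¹ C) * matWeight p B := fun C =>
    (hk2.comp measurable_prodMk_left).mul hw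
  have hfw : ∀ C, Measurable fun B : Fin p → Fin p → ℝ =>
      f (congrAct p (Matrix.of B) C) * matWeight p B := fun C =>
    (hf2.comp measurable_prodMk_left).mul hw
  have hkv : Measurable fun C => k C * symWeight p C := hk.mul hv
  have hfv : Measurable fun C => f C * symWeight p C := hf.mul hv
  have hcongr_one : ∀ {S : Matrix (Fin p) (Fin p) ℝ} {C : LowIdx p → ℝ}, symMat p C = Sᵀ * S →
      C = congrAct p S (lowCoords p 1) := fun {S C} h => by
    rw [congrAct_apply, symMat_lowCoords Matrix.isSymm_one, Matrix.mul_one, ← h, lowCoords_symMat]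
  have hleft : ∀ C, (∫⁻ B, k (congrAct p (Matrix.of B)⁻¹ (lowCoords p 1)) * matWeight p B) *
      (f C * symWeight p C) =
      ∫⁻ B, f C * symWeight p C * (k (congrAct p (Matrix.of B)⁻¹ C) * matWeight p B) := fun C => by
    rw [lintegral_const_mul _ (hkw C), mul_comm]
    by_cases hC : (symMat p C).PosDef
    · obtain ⟨S, hS, hCS⟩ := hC.exists_eq_transpose_mul_self
      have hS' : S⁻¹.det ≠ 0 := by
        rw [Matrix.det_nonsing_inv, Ring.inverse_eq_inv']; exact inv_ne_zero hS
      rw [← lintegral_rightMul hS' hk1]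
      congr 1
      refine lintegral_congr fun B => ?_
      rw [of_rightMul, Matrix.mul_inv_rev, Matrix.nonsing_inv_nonsing_inv _ hS.isUnit,
        congrAct_mul, LinearMap.comp_apply, ← hcongr_one hCS]
    · rw [symWeight_of_not_posDef hC]; simp
  have hright : ∀ C, ∫⁻ B, k C * symWeight p C * (f (congrAct p (Matrix.of B) C) * matWeight p B) =
      k C * symWeight p C * ∫⁻ B, f (gramCoords p B) * matWeight p B := fun C => by
    rw [lintegral_const_mul _ (hfw C)]
    by_cases hC : (symMat p C).PosDef
    · obtain ⟨S, hS, hCS⟩ := hC.exists_eq_transpose_mul_self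
      rw [← lintegral_leftMul hS hfg]
      congr 1
      refine lintegral_congr fun B => ?_
      rw [gramCoords_eq_congrAct, of_leftMul, congrAct_mul, LinearMap.comp_apply,
        ← hcongr_one hCS]
    · rw [symWeight_of_not_posDef hC]; simp
  have hmid : ∀ B, ∫⁻ C, f C * symWeight p C * (k (congrAct p (Matrix.of B)⁻¹ C) * matWeight p B) =
      ∫⁻ C, k C * symWeight p C * (f (congrAct p (Matrix.of B) C) * matWeight p B) := fun B => by
    by_cases hB : (Matrix.of B).det = 0
    · simp [matWeight_of_det_eq_zero hp hB]
    · have hfB : Measurable fun C => f (congrAct p (Matrix.of B) C) :=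
        hf.comp (congrAct p (Matrix.of B)).continuous_of_finiteDimensional.measurable
      have hF : Measurable fun C => f (congrAct p (Matrix.of B) C) * k C * matWeight p B :=
        (hfB.mul hk).mul_const _
      have hB' : (Matrix.of B)⁻¹.det ≠ 0 := by
        rw [Matrix.det_nonsing_inv, Ring.inverse_eq_inv']; exact inv_ne_zero hB
      have h := lintegral_congrAct hB' hF
      have hinv : ∀ C, congrAct p (Matrix.of B) (congrAct p (Matrix.of B)⁻¹ C) = C := fun C => by
        rw [← LinearMap.comp_apply, ← congrAct_mul,
          Matrix.nonsing_inv_mul _ (Ne.isUnit hB), congrAct_one, LinearMap.id_apply]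
      simp only [hinv] at h
      convert h using 3 <;> ring
  rw [← lintegral_const_mul _ hfv, ← lintegral_mul_const _ hkv]
  simp only [hleft, ← hright]
  rw [lintegral_lintegral_swap]
  · simp only [hmid]
    rw [lintegral_lintegral_swap]
    exact (((hk.comp measurable_snd).mul (hv.comp measurable_snd)).mul
      ((hf2.comp measurable_swap).mul (hw.comp measurable_fst))).aemeasurable
  · exact (((hf.comp measurable_fst).mul (hv.comp measurable_fst)).mul
      (hk2.mul (hw.comp measurable_snd))).aemeasurable

/-- A relatively compact neighbourhood of the identity in the positive definite cone. -/
def unitNhd (p : ℕ) : Set (LowIdx p → ℝ) :=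
  {C | (symMat p C).PosDef ∧ (symMat p C).trace < p + 1 ∧ (symMat p C)⁻¹.trace < p + 1}

theorem measurableSet_unitNhd (p : ℕ) : MeasurableSet (unitNhd p) := by
  have h : ∀ i j, Measurable fun C : LowIdx p → ℝ => symMat p C i j := fun i j =>
    ((continuous_symMat p).matrix_elem i j).measurable
  have h1 : Measurable fun C : LowIdx p → ℝ => (symMat p C).trace :=
    (continuous_symMat p).matrix_trace.measurable
  have h2 : Measurable fun C : LowIdx p → ℝ => (symMat p C)⁻¹.trace :=
    Finset.measurable_sum _ fun i _ => measurable_inv_apply h i i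
  exact (isOpen_setOf_posDef p).measurableSet.inter
    ((measurableSet_lt h1 measurable_const).inter (measurableSet_lt h2 measurable_const))

theorem unitNhd_mem_nhds (p : ℕ) : unitNhd p ∈ nhds (lowCoords p 1) := by
  have h1 : symMat p (lowCoords p 1) = 1 := symMat_lowCoords Matrix.isSymm_one
  have hS : ContinuousAt (symMat p) (lowCoords p 1) := (continuous_symMat p).continuousAt
  have hI : ContinuousAt (fun C => (symMat p C)⁻¹) (lowCoords p 1) :=
    ContinuousAt.comp (Matrix.continuousAt_inv_of_det_ne_zero (by simp [h1])) hS
  have htr : Continuous fun M : Matrix (Fin p) (Fin p) ℝ => M.trace := continuous_id.matrix_trace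
  have ha := (isOpen_setOf_posDef p).mem_nhds
    (show (symMat p (lowCoords p 1)).PosDef by rw [h1]; exact Matrix.PosDef.one)
  have hb := (htr.continuousAt.comp hS).eventually_lt
    (continuousAt_const (y := (p : ℝ) + 1)) (by simp [h1])
  have hc := (ContinuousAt.comp htr.continuousAt hI).eventually_lt
    (continuousAt_const (y := (p : ℝ) + 1)) (by simp [h1])
  filter_upwards [ha, hb, hc] with C h₁ h₂ h₃ using ⟨h₁, h₂, h₃⟩

theorem abs_apply_le_of_trace_lt {p : ℕ} {M : Matrix (Fin p) (Fin p) ℝ}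
    (h : (Mᵀ * M).trace < p + 1) (i j : Fin p) : |M i j| ≤ p + 1 := by
  have h1 : M i j ^ 2 ≤ (Mᵀ * M).trace := by
    simp only [Matrix.trace, Matrix.diag_apply, Matrix.mul_apply, Matrix.transpose_apply, ← sq]
    calc M i j ^ 2 ≤ ∑ k, M k j ^ 2 :=
          Finset.single_le_sum (f := fun k => M k j ^ 2) (fun k _ => sq_nonneg _) (Finset.mem_univ i)
      _ ≤ _ := Finset.single_le_sum (f := fun l => ∑ k, M k l ^ 2)
          (fun l _ => Finset.sum_nonneg fun k _ => sq_nonneg _) (Finset.mem_univ j)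
  have hp : (0 : ℝ) ≤ p := p.cast_nonneg
  exact abs_le_of_sq_le_sq (by nlinarith) (by linarith)

/-- An upper bound for the determinant of `p × p` matrices with entries at most `p + 1`. -/
noncomputable def detBound (p : ℕ) : ℝ := (p.factorial : ℝ) * ((p : ℝ) + 1) ^ p

theorem abs_det_le_detBound {p : ℕ} {M : Matrix (Fin p) (Fin p) ℝ}
    (h : (Mᵀ * M).trace < p + 1) : |M.det| ≤ detBound p := by
  have := Matrix.det_le (abv := AbsoluteValue.abs) (A := M) (abs_apply_le_of_trace_lt h)
  simpa [detBound] using this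

theorem lintegral_unitNhd_symWeight_lt_top (p : ℕ) :
    ∫⁻ C, (unitNhd p).indicator 1 C * symWeight p C < ∞ := by
  set R : ℝ := p * ((p : ℝ) + 1) ^ 2 with hR
  set b : ℝ≥0∞ := ENNReal.ofReal ((detBound p ^ 2) ^ (((p : ℝ) + 1) / 2))
  have hle : ∀ C, (unitNhd p).indicator 1 C * symWeight p C ≤
      (Metric.closedBall (0 : LowIdx p → ℝ) R).indicator (fun _ => b) C := fun C => by
    by_cases hC : C ∈ unitNhd p
    · obtain ⟨h₁, h₂, h₃⟩ := hC
      have hball : C ∈ Metric.closedBall (0 : LowIdx p → ℝ) R := by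
        obtain ⟨S, -, hS⟩ := h₁.exists_eq_transpose_mul_self
        rw [hS] at h₂
        rw [mem_closedBall_zero_iff, pi_norm_le_iff_of_nonneg (by positivity)]
        rintro ⟨⟨i, j⟩, hij⟩
        rw [← symMat_apply_le C hij, hS, Real.norm_eq_abs, Matrix.mul_apply]
        refine (Finset.abs_sum_le_sum_abs _ _).trans ?_
        refine (Finset.sum_le_card_nsmul _ _ (((p : ℝ) + 1) ^ 2) fun k _ => ?_).trans_eq
          (by simp [hR])
        rw [abs_mul, sq]
        exact mul_le_mul (abs_apply_le_of_trace_lt h₂ _ _) (abs_apply_le_of_trace_lt h₂ _ _)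
          (abs_nonneg _) (by positivity)
      rw [Set.indicator_of_mem hball, Set.indicator_of_mem (show C ∈ unitNhd p from ⟨h₁, h₂, h₃⟩),
        Pi.one_apply, one_mul, symWeight_of_posDef h₁]
      refine ENNReal.ofReal_le_ofReal ?_
      obtain ⟨T, -, hT⟩ := h₁.inv.exists_eq_transpose_mul_self
      rw [hT] at h₃
      have hdet : (symMat p C).det⁻¹ = |T.det| ^ 2 := by
        rw [← Ring.inverse_eq_inv', ← Matrix.det_nonsing_inv, hT, Matrix.det_mul,
          Matrix.det_transpose, sq_abs, sq]
      rw [neg_div, Real.rpow_neg h₁.det_pos.le, ← Real.inv_rpow h₁.det_pos.le, hdet]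
      exact Real.rpow_le_rpow (by positivity)
        (pow_le_pow_left₀ (abs_nonneg _) (abs_det_le_detBound h₃) 2) (by positivity)
    · rw [Set.indicator_of_notMem hC, zero_mul]
      exact zero_le
  refine (lintegral_mono hle).trans_lt ?_
  rw [lintegral_indicator_const measurableSet_closedBall]
  exact ENNReal.mul_lt_top ENNReal.ofReal_lt_top measure_closedBall_lt_top

theorem lintegral_unitNhd_symWeight_pos (p : ℕ) :
    0 < ∫⁻ C, (unitNhd p).indicator 1 C * symWeight p C := by
  refine (lintegral_pos_iff_support
    ((measurable_one.indicator (measurableSet_unitNhd p)).mul (measurable_symWeight p))).2 ?_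
  refine Measure.measure_pos_of_mem_nhds _
    (Filter.mem_of_superset (unitNhd_mem_nhds p) fun C hC => ?_)
  change (unitNhd p).indicator (1 : (LowIdx p → ℝ) → ℝ≥0∞) C * symWeight p C ≠ 0
  rw [Set.indicator_of_mem hC, Pi.one_apply, one_mul, symWeight_of_posDef hC.1]
  exact (ENNReal.ofReal_pos.2 (Real.rpow_pos_of_pos hC.1.det_pos _)).ne'

theorem measurable_unitNhd_congrAct_inv (p : ℕ) : Measurable fun B : Fin p → Fin p → ℝ =>
    (unitNhd p).indicator (1 : (LowIdx p → ℝ) → ℝ≥0∞)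
      (congrAct p (Matrix.of B)⁻¹ (lowCoords p 1)) :=
  (measurable_one.indicator (measurableSet_unitNhd p)).comp
    (measurable_congrAct_apply (measurable_inv_apply fun i j =>
      ((continuous_matrix_of p).matrix_elem i j).measurable) measurable_const)

theorem lintegral_unitNhd_matWeight_lt_top (p : ℕ) :
    ∫⁻ B, (unitNhd p).indicator 1 (congrAct p (Matrix.of B)⁻¹ (lowCoords p 1)) * matWeight p B
      < ∞ := by
  set b : ℝ≥0∞ := ENNReal.ofReal (detBound p ^ p)
  have hle : ∀ B, (unitNhd p).indicator 1 (congrAct p (Matrix.of B)⁻¹ (lowCoords p 1)) *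
      matWeight p B ≤
      (Metric.closedBall (0 : Fin p → Fin p → ℝ) (p + 1)).indicator (fun _ => b) B := fun B => by
    by_cases hB : congrAct p (Matrix.of B)⁻¹ (lowCoords p 1) ∈ unitNhd p
    · have hB' := hB
      obtain ⟨h₁, h₂, h₃⟩ := hB'
      rw [symMat_congrAct, symMat_lowCoords Matrix.isSymm_one, Matrix.mul_one] at h₁ h₂ h₃
      have hd : (Matrix.of B).det ≠ 0 := fun h => by
        have := h₁.det_pos
        simp [Matrix.det_nonsing_inv, h] at this
      rw [Matrix.mul_inv_rev, Matrix.transpose_nonsing_inv,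
        Matrix.nonsing_inv_nonsing_inv _ hd.isUnit,
        Matrix.nonsing_inv_nonsing_inv _ (by simpa using hd), Matrix.trace_mul_comm] at h₃
      have hball : B ∈ Metric.closedBall (0 : Fin p → Fin p → ℝ) (p + 1) := by
        rw [mem_closedBall_zero_iff, pi_norm_le_iff_of_nonneg (by positivity)]
        refine fun i => (pi_norm_le_iff_of_nonneg (by positivity)).2 fun j => ?_
        exact abs_apply_le_of_trace_lt h₃ i j
      rw [Set.indicator_of_mem hball, Set.indicator_of_mem hB, Pi.one_apply, one_mul, matWeight,
        ← abs_inv, ← Ring.inverse_eq_inv', ← Matrix.det_nonsing_inv]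
      exact ENNReal.ofReal_le_ofReal
        (pow_le_pow_left₀ (abs_nonneg _) (abs_det_le_detBound h₂) p)
    · rw [Set.indicator_of_notMem hB, zero_mul]
      exact zero_le
  refine (lintegral_mono hle).trans_lt ?_
  rw [lintegral_indicator_const measurableSet_closedBall]
  exact ENNReal.mul_lt_top ENNReal.ofReal_lt_top measure_closedBall_lt_top

theorem lintegral_unitNhd_matWeight_pos (p : ℕ) :
    0 < ∫⁻ B, (unitNhd p).indicator 1 (congrAct p (Matrix.of B)⁻¹ (lowCoords p 1)) *
      matWeight p B := by
  refine (lintegral_pos_iff_support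
    ((measurable_unitNhd_congrAct_inv p).mul (measurable_matWeight p))).2 ?_
  set B₀ : Fin p → Fin p → ℝ := Matrix.of.symm 1 with hB₀
  have hof : Matrix.of B₀ = 1 := Matrix.of.apply_symm_apply 1
  have hcont : ContinuousAt (fun B : Fin p → Fin p → ℝ =>
      congrAct p (Matrix.of B)⁻¹ (lowCoords p 1)) B₀ := by
    have hI : ContinuousAt (fun B : Fin p → Fin p → ℝ => (Matrix.of B)⁻¹) B₀ :=
      ContinuousAt.comp (Matrix.continuousAt_inv_of_det_ne_zero (by simp [hof]))
        (continuous_matrix_of p).continuousAt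
    have hg : Continuous fun M : Matrix (Fin p) (Fin p) ℝ => congrAct p M (lowCoords p 1) := by
      simp only [congrAct_apply]
      exact (continuous_lowCoords p).comp
        ((continuous_id.matrix_transpose.matrix_mul continuous_const).matrix_mul continuous_id)
    exact ContinuousAt.comp hg.continuousAt hI
  have hmem : unitNhd p ∈ nhds (congrAct p (Matrix.of B₀)⁻¹ (lowCoords p 1)) := by
    rw [hof, inv_one, congrAct_one]
    exact unitNhd_mem_nhds p
  refine Measure.measure_pos_of_mem_nhds _ (Filter.mem_of_superset (hcont hmem) fun B hB => ?_)
  have hd : (Matrix.of B).det ≠ 0 := fun h => by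
    have := hB.1.det_pos
    rw [symMat_congrAct, symMat_lowCoords Matrix.isSymm_one] at this
    simp [Matrix.det_nonsing_inv, h] at this
  change (unitNhd p).indicator (1 : (LowIdx p → ℝ) → ℝ≥0∞)
    (congrAct p (Matrix.of B)⁻¹ (lowCoords p 1)) * matWeight p B ≠ 0
  rw [Set.indicator_of_mem (show congrAct p (Matrix.of B)⁻¹ (lowCoords p 1) ∈ unitNhd p from hB),
    Pi.one_apply, one_mul, matWeight]
  exact (ENNReal.ofReal_pos.2 (by positivity)).ne'

/-- The image of the Haar measure on invertible matrices under `B ↦ B'B` is proportional to the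
invariant measure on the positive definite cone. -/
theorem exists_lintegral_gramCoords_eq {p : ℕ} (hp : 1 ≤ p) :
    ∃ a : ℝ, 0 < a ∧ ∀ f : (LowIdx p → ℝ) → ℝ≥0∞, Measurable f →
      ∫⁻ B, f (gramCoords p B) * matWeight p B =
        ENNReal.ofReal a * ∫⁻ C, f C * symWeight p C := by
  have hk : Measurable ((unitNhd p).indicator (1 : (LowIdx p → ℝ) → ℝ≥0∞)) :=
    measurable_one.indicator (measurableSet_unitNhd p)
  have h₁ := lintegral_unitNhd_matWeight_pos p
  have h₂ := lintegral_unitNhd_matWeight_lt_top p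
  have h₃ := lintegral_unitNhd_symWeight_pos p
  have h₄ := lintegral_unitNhd_symWeight_lt_top p
  have key := fun f hf => lintegral_symWeight_mul_eq_lintegral_gramCoords (f := f) hp hk hf
  set K := ∫⁻ B, (unitNhd p).indicator 1 (congrAct p (Matrix.of B)⁻¹ (lowCoords p 1)) *
    matWeight p B
  set k₀ := ∫⁻ C, (unitNhd p).indicator 1 C * symWeight p C
  have hfin : k₀⁻¹ * K ≠ ∞ := ENNReal.mul_ne_top (ENNReal.inv_ne_top.2 h₃.ne') h₂.ne
  refine ⟨(k₀⁻¹ * K).toReal, ENNReal.toReal_pos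
    (mul_ne_zero (ENNReal.inv_ne_zero.2 h₄.ne) h₁.ne') hfin, fun f hf => ?_⟩
  rw [ENNReal.ofReal_toReal hfin, mul_assoc, key f hf, ← mul_assoc,
    ENNReal.inv_mul_cancel h₃.ne' h₄.ne, one_mul]

/-- Lemma 1 of the paper: the Jacobian identity for `B ↦ n B'B`.  There is a
constant `c > 0` depending only on `n, p` such that for every measurable set `D` of symmetric
matrices (in lower-triangular coordinates),
`∫_{n B'B ∈ D} exp(-(n/2) tr(B'B)) |det B|^{n-p-1} dB
  = c ∫_{D ∩ PD(p)} exp(-tr C/2) (det C)^{(n-p-2)/2} dC`. -/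
theorem wishart_jacobian_identity (p n : ℕ) (hp : 1 ≤ p) (hn : p + 2 ≤ n) :
    ∃ c : ℝ, 0 < c ∧ ∀ D : Set (LowIdx p → ℝ), MeasurableSet D →
      (∫⁻ B in {B : Fin p → Fin p → ℝ |
          lowCoords p ((n : ℝ) • ((Matrix.of B)ᵀ * Matrix.of B)) ∈ D},
        ENNReal.ofReal (Real.exp (-((n : ℝ) / 2) * Matrix.trace ((Matrix.of B)ᵀ * Matrix.of B)) *
          |(Matrix.of B).det| ^ (n - p - 1)))
      = ENNReal.ofReal c *
        (∫⁻ C in D ∩ {C : LowIdx p → ℝ | (symMat p C).PosDef},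
          ENNReal.ofReal (Real.exp (-(1 / 2) * Matrix.trace (symMat p C)) *
            (symMat p C).det ^ (((n : ℝ) - (p : ℝ) - 2) / 2))) := by
  obtain ⟨a, ha, key⟩ := exists_lintegral_gramCoords_eq hp
  have hn0 : (0 : ℝ) < n := by exact_mod_cast (by omega : 0 < n)
  set κ : ℝ := ((n : ℝ) ^ p) ^ (((n : ℝ) - 1) / 2) with hκ_def
  have hκ : 0 < κ := by positivity
  refine ⟨κ⁻¹ * a, by positivity, fun D hD => ?_⟩
  set g : (LowIdx p → ℝ) → ℝ≥0∞ := fun C => ENNReal.ofReal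
    (Real.exp (-(1 / 2) * (symMat p C).trace) * (symMat p C).det ^ (((n : ℝ) - 1) / 2))
  have hg : Measurable g := by
    have h1 : Measurable fun C : LowIdx p → ℝ => (symMat p C).trace :=
      (continuous_symMat p).matrix_trace.measurable
    have h2 : Measurable fun C : LowIdx p → ℝ => (symMat p C).det :=
      (continuous_symMat p).matrix_det.measurable
    fun_prop
  set A : Matrix (Fin p) (Fin p) ℝ := √(n : ℝ) • 1 with hA_def
  have hA : A.det ≠ 0 := by
    rw [hA_def, Matrix.det_smul, Matrix.det_one, mul_one]
    positivity
  have hgram : ∀ B, gramCoords p (leftMul p A B) =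
      lowCoords p ((n : ℝ) • ((Matrix.of B)ᵀ * Matrix.of B)) := fun B => by
    rw [gramCoords, of_leftMul, hA_def, Matrix.smul_mul, Matrix.one_mul, Matrix.transpose_smul,
      Matrix.smul_mul, Matrix.mul_smul, smul_smul, Real.mul_self_sqrt hn0.le]
  have hset : MeasurableSet {B : Fin p → Fin p → ℝ |
      lowCoords p ((n : ℝ) • ((Matrix.of B)ᵀ * Matrix.of B)) ∈ D} := by
    simp only [← hgram]
    exact ((continuous_gramCoords p).measurable.comp
      (leftMul p A).continuous_of_finiteDimensional.measurable) hD
  have hleft : ∀ B : Fin p → Fin p → ℝ,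
      Set.indicator {B : Fin p → Fin p → ℝ |
          lowCoords p ((n : ℝ) • ((Matrix.of B)ᵀ * Matrix.of B)) ∈ D} (fun B =>
        ENNReal.ofReal (Real.exp (-((n : ℝ) / 2) * Matrix.trace ((Matrix.of B)ᵀ * Matrix.of B)) *
          |(Matrix.of B).det| ^ (n - p - 1))) B =
      ENNReal.ofReal κ⁻¹ * (D.indicator g (gramCoords p (leftMul p A B)) * matWeight p B) := by
    intro B
    rw [hgram]
    by_cases hB : lowCoords p ((n : ℝ) • ((Matrix.of B)ᵀ * Matrix.of B)) ∈ D
    · rw [Set.indicator_of_mem hB, Set.indicator_of_mem (show B ∈ {B : Fin p → Fin p → ℝ |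
        lowCoords p ((n : ℝ) • ((Matrix.of B)ᵀ * Matrix.of B)) ∈ D} from hB)]
      by_cases hd : (Matrix.of B).det = 0
      · rw [matWeight_of_det_eq_zero hp hd, hd, abs_zero, zero_pow (by omega)]
        simp
      · have hd' : 0 < |(Matrix.of B).det| := abs_pos.2 hd
        have hsymm : ((n : ℝ) • ((Matrix.of B)ᵀ * Matrix.of B)).IsSymm :=
          (Matrix.isSymm_transpose_mul_self _).smul _
        have hdet : ((n : ℝ) • ((Matrix.of B)ᵀ * Matrix.of B)).det ^ (((n : ℝ) - 1) / 2) =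
            κ * |(Matrix.of B).det| ^ (n - 1) := by
          rw [Matrix.det_smul, Matrix.det_mul, Matrix.det_transpose, Fintype.card_fin,
            Real.mul_rpow (by positivity) (mul_self_nonneg _), ← abs_mul_abs_self, ← sq,
            ← Real.rpow_natCast _ 2, ← Real.rpow_mul hd'.le, ← Real.rpow_natCast _ (n - 1),
            Nat.cast_sub (by omega)]
          congr 2
          push_cast
          ring
        have hpow : |(Matrix.of B).det| ^ (n - 1) =
            |(Matrix.of B).det| ^ (n - p - 1) * |(Matrix.of B).det| ^ p := by
          rw [← pow_add]; congr 1; omega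
        simp only [g, matWeight]
        rw [symMat_lowCoords hsymm, hdet, hpow, ← ENNReal.ofReal_mul (by positivity),
          ← ENNReal.ofReal_mul (by positivity), Matrix.trace_smul, smul_eq_mul, inv_pow]
        congr 1
        field_simp
    · rw [Set.indicator_of_notMem hB, Set.indicator_of_notMem (show B ∉ {B : Fin p → Fin p → ℝ |
        lowCoords p ((n : ℝ) • ((Matrix.of B)ᵀ * Matrix.of B)) ∈ D} from hB)]
      simp
  have hright : ∀ C : LowIdx p → ℝ, D.indicator g C * symWeight p C =
      Set.indicator (D ∩ {C : LowIdx p → ℝ | (symMat p C).PosDef}) (fun C =>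
        ENNReal.ofReal (Real.exp (-(1 / 2) * Matrix.trace (symMat p C)) *
          (symMat p C).det ^ (((n : ℝ) - (p : ℝ) - 2) / 2))) C := by
    intro C
    rw [Set.inter_comm, ← Set.indicator_indicator]
    by_cases hC : (symMat p C).PosDef
    · rw [Set.indicator_of_mem (s := {C | (symMat p C).PosDef}) hC, symWeight_of_posDef hC]
      by_cases hCD : C ∈ D
      · rw [Set.indicator_of_mem hCD, Set.indicator_of_mem hCD,
          ← ENNReal.ofReal_mul (mul_nonneg (Real.exp_nonneg _) (Real.rpow_nonneg hC.det_pos.le _)),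
          mul_assoc, ← Real.rpow_add hC.det_pos]
        congr 3
        ring
      · rw [Set.indicator_of_notMem hCD, Set.indicator_of_notMem hCD, zero_mul]
    · rw [Set.indicator_of_notMem (s := {C | (symMat p C).PosDef}) hC,
        symWeight_of_not_posDef hC, mul_zero]
  have hF : Measurable (D.indicator g) := hg.indicator hD
  have hFB : Measurable fun B => D.indicator g (gramCoords p B) :=
    hF.comp (continuous_gramCoords p).measurable
  have hFA : Measurable fun B => D.indicator g (gramCoords p (leftMul p A B)) * matWeight p B :=
    (hFB.comp (leftMul p A).continuous_of_finiteDimensional.measurable).mul (measurable_matWeight p)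
  rw [← lintegral_indicator hset,
    ← lintegral_indicator (hD.inter (isOpen_setOf_posDef p).measurableSet)]
  simp only [hleft, ← hright]
  rw [lintegral_const_mul _ hFA, lintegral_leftMul hA hFB, key _ hF, ← mul_assoc,
    ← ENNReal.ofReal_mul (by positivity)]
end
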